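/- arXiv:1502.05205 — 4 statements merged into one kernel-verified Lean document; each statement's English description precedes it below -/
import Mathlib

section
/- Hardy inequality in the half-space with two weights (Example 5.5): let n ≥ 2, μ ≤ 1/4 and η(μ) := n − 1 + √(1 − 4μ). Then for every φ ∈ C_c^∞(ℝⁿ₊): ∫_{ℝⁿ₊} |∇φ(x)|² dx − μ ∫_{ℝⁿ₊} φ(x)²/x₁² dx ≥ (η(μ)²/4) ∫_{ℝⁿ₊} φ(x)²/|x|² dx. In particular, for μ = 0 this gives ∫|∇φ|² ≥ (n²/4)∫ φ²/|x|², and for μ = 1/4 it gives ∫|∇φ|² − (1/4)∫φ²/x₁² ≥ ((n−1)²/4)∫φ²/|x|². -/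
open MeasureTheory

noncomputable section

/-- Test functions: smooth compactly supported functions with support in `Ω`. -/
def IsTestFun {n : ℕ} (Ω : Set (EuclideanSpace ℝ (Fin n)))
    (φ : EuclideanSpace ℝ (Fin n) → ℝ) : Prop :=
  ContDiff ℝ (⊤ : ℕ∞) φ ∧ HasCompactSupport φ ∧ tsupport φ ⊆ Ω

/-- The open half-space `{x ∈ ℝⁿ : x₁ > 0}`. -/
def Hplus (n : ℕ) [NeZero n] : Set (EuclideanSpace ℝ (Fin n)) := {x | 0 < x 0}

lemma integral_fderiv_zero {n : ℕ} (g : EuclideanSpace ℝ (Fin n) → ℝ)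
    (hg : ContDiff ℝ 1 g) (hc : HasCompactSupport g) (v : EuclideanSpace ℝ (Fin n)) :
    Integrable (fun x => fderiv ℝ g x v) ∧ ∫ x, fderiv ℝ g x v = 0 := by
  have hi : Integrable (fun x => fderiv ℝ g x v) :=
    ((hg.continuous_fderiv (by norm_num)).clm_apply continuous_const).integrable_of_hasCompactSupport
      (hc.fderiv_apply (𝕜 := ℝ) v)
  refine ⟨hi, ?_⟩
  have := integral_mul_fderiv_eq_neg_fderiv_mul_of_integrable (μ := volume)
    (f := fun _ : EuclideanSpace ℝ (Fin n) => (1:ℝ)) (g := g) (v := v) (by simp) (by simpa using hi)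
    (by simpa using hg.continuous.integrable_of_hasCompactSupport hc)
    (fun x _ => by fun_prop) (fun x _ => (hg.differentiable (by norm_num)) x)
  simpa using this

lemma contDiff_test_mul {n : ℕ} [NeZero n] (φ h : EuclideanSpace ℝ (Fin n) → ℝ)
    (hφ : IsTestFun (Hplus n) φ) (hh : ∀ x ∈ Hplus n, ContDiffAt ℝ 1 h x) :
    ContDiff ℝ 1 (fun x => φ x ^ 2 * h x) ∧ HasCompactSupport (fun x => φ x ^ 2 * h x) := by
  obtain ⟨h1, h2, h3⟩ := hφ
  constructor
  · rw [contDiff_iff_contDiffAt]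
    intro x
    by_cases hx : x ∈ tsupport φ
    · exact ((h1.contDiffAt.of_le (by exact_mod_cast le_top)).pow 2).mul (hh x (h3 hx))
    · have : (fun x => φ x ^ 2 * h x) =ᶠ[nhds x] fun _ => 0 := by
        filter_upwards [notMem_tsupport_iff_eventuallyEq.1 hx] with y hy
        simp [hy]
      exact contDiffAt_const.congr_of_eventuallyEq this
  · refine h2.mono ?_
    intro x hx
    contrapose! hx
    simp only [Function.mem_support, not_not] at hx ⊢
    simp [hx]

lemma ne_zero_of_mem {n : ℕ} [NeZero n] {x : EuclideanSpace ℝ (Fin n)} (hx : x ∈ Hplus n) :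
    x ≠ 0 := by
  rintro rfl
  simp [Hplus] at hx

lemma fderiv_sq_mul {n : ℕ} (φ h : EuclideanSpace ℝ (Fin n) → ℝ)
    (x v : EuclideanSpace ℝ (Fin n)) (hφ : DifferentiableAt ℝ φ x)
    (h' : EuclideanSpace ℝ (Fin n) →L[ℝ] ℝ) (hh : HasFDerivAt h h' x) :
    fderiv ℝ (fun x => φ x ^ 2 * h x) x v =
      2 * φ x * fderiv ℝ φ x v * h x + φ x ^ 2 * h' v := by
  have := ((hφ.hasFDerivAt.pow 2).mul hh).fderiv
  have e : (fun x => φ x ^ 2 * h x) = (fun x => φ x ^ 2) * h := rfl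
  rw [e, this]
  simp
  ring

lemma hasFDerivAt_coord {n : ℕ} (i : Fin n) (x : EuclideanSpace ℝ (Fin n)) :
    HasFDerivAt (fun y : EuclideanSpace ℝ (Fin n) => y i)
      (EuclideanSpace.proj i : EuclideanSpace ℝ (Fin n) →L[ℝ] ℝ) x :=
  (EuclideanSpace.proj i : EuclideanSpace ℝ (Fin n) →L[ℝ] ℝ).hasFDerivAt

lemma contDiff_coord {n : ℕ} (i : Fin n) :
    ContDiff ℝ 1 (fun y : EuclideanSpace ℝ (Fin n) => y i) :=
  (EuclideanSpace.proj i : EuclideanSpace ℝ (Fin n) →L[ℝ] ℝ).contDiff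

lemma fderiv_G {n : ℕ} [NeZero n] (φ : EuclideanSpace ℝ (Fin n) → ℝ)
    (x : EuclideanSpace ℝ (Fin n)) (hx : x ∈ Hplus n) (hφ : DifferentiableAt ℝ φ x) :
    fderiv ℝ (fun x => φ x ^ 2 * (x 0)⁻¹) x (EuclideanSpace.single 0 1) =
      2 * φ x * fderiv ℝ φ x (EuclideanSpace.single 0 1) / x 0 - φ x ^ 2 / (x 0) ^ 2 := by
  have hx0 : x 0 ≠ 0 := ne_of_gt hx
  have h := (hasDerivAt_inv hx0).comp_hasFDerivAt x (hasFDerivAt_coord 0 x)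
  rw [fderiv_sq_mul φ (fun x => (x 0)⁻¹) x _ hφ _ h]
  simp
  ring

lemma fderiv_H {n : ℕ} [NeZero n] (φ : EuclideanSpace ℝ (Fin n) → ℝ)
    (x : EuclideanSpace ℝ (Fin n)) (hx : x ∈ Hplus n) (hφ : DifferentiableAt ℝ φ x) (i : Fin n) :
    fderiv ℝ (fun x => φ x ^ 2 * (x i * (‖x‖ ^ 2)⁻¹)) x (EuclideanSpace.single i 1) =
      2 * φ x / ‖x‖ ^ 2 * (x i * fderiv ℝ φ x (EuclideanSpace.single i 1))
        + φ x ^ 2 / ‖x‖ ^ 2 - 2 * φ x ^ 2 / ‖x‖ ^ 4 * (x i) ^ 2 := by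
  have hx0 : ‖x‖ ^ 2 ≠ 0 := by simpa using ne_zero_of_mem hx
  have h := (hasFDerivAt_coord i x).mul
    ((hasDerivAt_inv hx0).comp_hasFDerivAt x (hasStrictFDerivAt_norm_sq x).hasFDerivAt)
  rw [fderiv_sq_mul φ (fun x => x i * (‖x‖ ^ 2)⁻¹) x _ hφ _ h]
  simp [EuclideanSpace.inner_single_right]
  field_simp
  ring

lemma sum_fderiv_H {n : ℕ} [NeZero n] (φ : EuclideanSpace ℝ (Fin n) → ℝ)
    (x : EuclideanSpace ℝ (Fin n)) (hx : x ∈ Hplus n) (hφ : DifferentiableAt ℝ φ x) :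
    ∑ i, fderiv ℝ (fun x => φ x ^ 2 * (x i * (‖x‖ ^ 2)⁻¹)) x (EuclideanSpace.single i 1) =
      2 * φ x / ‖x‖ ^ 2 * fderiv ℝ φ x x + (n - 2) * (φ x ^ 2 / ‖x‖ ^ 2) := by
  have hx0 : ‖x‖ ≠ 0 := by simpa using ne_zero_of_mem hx
  have e1 : ∑ i, x i * fderiv ℝ φ x (EuclideanSpace.single i 1) = fderiv ℝ φ x x := by
    have : x = ∑ i, x i • (EuclideanSpace.single i (1:ℝ)) := by
      ext j
      simp [Finset.sum_apply, Pi.single_apply]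
    conv_rhs => rw [this]
    rw [map_sum]
    simp only [map_smul, smul_eq_mul]
    rw [← this]
  have e2 : ∑ i, (x i) ^ 2 = ‖x‖ ^ 2 := by
    rw [EuclideanSpace.norm_sq_eq]; simp
  simp_rw [fderiv_H φ x hx hφ]
  rw [Finset.sum_sub_distrib, Finset.sum_add_distrib, ← Finset.mul_sum, ← Finset.mul_sum, e1, e2]
  simp
  field_simp
  ring

lemma pointwise_ineq {n : ℕ} [NeZero n] (φ : EuclideanSpace ℝ (Fin n) → ℝ)
    (x : EuclideanSpace ℝ (Fin n)) (hx : x ∈ Hplus n) (hφ : DifferentiableAt ℝ φ x) (α β : ℝ) :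
    α * fderiv ℝ (fun x => φ x ^ 2 * (x 0)⁻¹) x (EuclideanSpace.single 0 1)
      - β * ∑ i, fderiv ℝ (fun x => φ x ^ 2 * (x i * (‖x‖ ^ 2)⁻¹)) x (EuclideanSpace.single i 1)
     ≤ ‖gradient φ x‖ ^ 2 - (α * (1 - α)) * (φ x ^ 2 / (x 0) ^ 2)
       - (β * (2 * α + n - 2 - β)) * (φ x ^ 2 / ‖x‖ ^ 2) := by
  rw [fderiv_G φ x hx hφ, sum_fderiv_H φ x hx hφ]
  have hx0 : x 0 ≠ 0 := ne_of_gt hx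
  have hxn : ‖x‖ ≠ 0 := by simpa using ne_zero_of_mem hx
  have hL : ∀ v, fderiv ℝ φ x v = inner ℝ (gradient φ x) v := by
    intro v
    simp [gradient]
  rw [hL, hL]
  set g := gradient φ x
  set e : EuclideanSpace ℝ (Fin n) := EuclideanSpace.single 0 1 with he
  have hee : ‖e‖ ^ 2 = 1 := by simp [he]
  have hex : inner ℝ e x = x 0 := by simp [he, EuclideanSpace.inner_single_left]
  have h0 : 0 ≤ ‖g - ((φ x * α / x 0) • e - (φ x * β / ‖x‖ ^ 2) • x)‖ ^ 2 := by positivity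
  rw [norm_sub_sq_real, norm_sub_sq_real, inner_sub_right, inner_smul_right, inner_smul_right,
    inner_smul_right, real_inner_smul_left, norm_smul, norm_smul, mul_pow, mul_pow, hee, hex,
    Real.norm_eq_abs, Real.norm_eq_abs, sq_abs, sq_abs] at h0
  refine sub_nonneg.1 (h0.trans_eq ?_)
  field_simp
  ring

lemma hardy_general {n : ℕ} [NeZero n] (α β : ℝ)
    (φ : EuclideanSpace ℝ (Fin n) → ℝ) (hφ : IsTestFun (Hplus n) φ) :
    (β * (2 * α + n - 2 - β)) * ∫ x in Hplus n, (φ x) ^ 2 / ‖x‖ ^ 2 ≤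
        (∫ x in Hplus n, ‖gradient φ x‖ ^ 2)
          - (α * (1 - α)) * ∫ x in Hplus n, (φ x) ^ 2 / (x 0) ^ 2 := by
  have hd : ContDiff ℝ 1 φ := hφ.1.of_le (by exact_mod_cast le_top)
  have hφ0 : ∀ x, x ∉ Hplus n → φ x = 0 := fun x hx =>
    image_eq_zero_of_notMem_tsupport (fun h => hx (hφ.2.2 h))
  have hg0 : ∀ x, x ∉ Hplus n → gradient φ x = 0 := fun x hx => by
    have : fderiv ℝ φ x = 0 := image_eq_zero_of_notMem_tsupport
      (fun h => hx (hφ.2.2 (tsupport_fderiv_subset ℝ h)))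
    simp [gradient, this]
  have hn0 : ∀ x ∈ Hplus n, ‖x‖ ^ 2 ≠ 0 := fun x hx => by simpa using ne_zero_of_mem hx
  have hc0 : ∀ x ∈ Hplus n, x 0 ≠ 0 := fun x hx => ne_of_gt hx
  obtain ⟨G1, G2⟩ := contDiff_test_mul φ (fun x => (x 0)⁻¹) hφ
    (fun x hx => (contDiff_coord 0).contDiffAt.inv (hc0 x hx))
  have HH := fun i => contDiff_test_mul φ (fun x => x i * (‖x‖ ^ 2)⁻¹) hφ
    (fun x hx => (contDiff_coord i).contDiffAt.mul
      ((contDiff_norm_sq ℝ).contDiffAt.inv (hn0 x hx)))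
  obtain ⟨P1, P2⟩ := contDiff_test_mul φ (fun x => ((x 0) ^ 2)⁻¹) hφ
    (fun x hx => ((contDiff_coord 0).contDiffAt.pow 2).inv (pow_ne_zero 2 (hc0 x hx)))
  obtain ⟨Q1, Q2⟩ := contDiff_test_mul φ (fun x => (‖x‖ ^ 2)⁻¹) hφ
    (fun x hx => (contDiff_norm_sq ℝ).contDiffAt.inv (hn0 x hx))
  have iP : Integrable (fun x => φ x ^ 2 / (x 0) ^ 2) :=
    P1.continuous.integrable_of_hasCompactSupport P2
  have iQ : Integrable (fun x => φ x ^ 2 / ‖x‖ ^ 2) :=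
    Q1.continuous.integrable_of_hasCompactSupport Q2
  have iN : Integrable (fun x => ‖gradient φ x‖ ^ 2) := by
    have e : (fun x => ‖gradient φ x‖ ^ 2) = fun x => ‖fderiv ℝ φ x‖ ^ 2 := by
      funext x; simp [gradient]
    rw [e]
    refine Continuous.integrable_of_hasCompactSupport
      ((hd.continuous_fderiv (by norm_num)).norm.pow 2) ?_
    refine (hφ.2.1.fderiv (𝕜 := ℝ)).mono ?_
    intro x hx
    contrapose! hx
    simp only [Function.mem_support, not_not] at hx ⊢
    simp [hx]
  obtain ⟨iG, zG⟩ := integral_fderiv_zero _ G1 G2 (EuclideanSpace.single 0 1)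
  have IH := fun i => integral_fderiv_zero _ (HH i).1 (HH i).2 (EuclideanSpace.single i 1)
  rw [setIntegral_eq_integral_of_forall_compl_eq_zero (fun x hx => by simp [hφ0 x hx]),
    setIntegral_eq_integral_of_forall_compl_eq_zero (fun x hx => by simp [hg0 x hx]),
    setIntegral_eq_integral_of_forall_compl_eq_zero (fun x hx => by simp [hφ0 x hx])]
  have iS := integrable_finset_sum Finset.univ (fun i _ => (IH i).1)
  have zS := integral_finset_sum Finset.univ (fun i _ => (IH i).1)
  simp only [(IH _).2, Finset.sum_const_zero] at zS
  have key := integral_mono ((iG.const_mul α).sub (iS.const_mul β))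
    ((iN.sub (iP.const_mul (α * (1 - α)))).sub (iQ.const_mul (β * (2 * α + n - 2 - β)))) ?_
  · rw [integral_sub' (iG.const_mul α) (iS.const_mul β),
      integral_sub' (iN.sub (iP.const_mul (α * (1 - α)))) (iQ.const_mul (β * (2 * α + n - 2 - β))),
      integral_sub' iN (iP.const_mul (α * (1 - α))),
      integral_const_mul, integral_const_mul, integral_const_mul, integral_const_mul, zG, zS] at key
    linarith
  · intro x
    by_cases hx : x ∈ Hplus n
    · exact pointwise_ineq φ x hx (hd.differentiable (by norm_num) x) α β
    · have ht : x ∉ tsupport φ := fun h => hx (hφ.2.2 h)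
      have hz : ∀ h : EuclideanSpace ℝ (Fin n) → ℝ, fderiv ℝ (fun x => φ x ^ 2 * h x) x = 0 := by
        intro h
        have : (fun x => φ x ^ 2 * h x) =ᶠ[nhds x] fun _ => 0 := by
          filter_upwards [notMem_tsupport_iff_eventuallyEq.1 ht] with y hy
          simp [hy]
        rw [this.fderiv_eq]; simp
      simp [hz, hφ0 x hx, hg0 x hx]

/-- Hardy inequality in the half-space with two weights (Example 5.5); the particular
cases `μ = 0` and `μ = 1/4` are stated as well. -/
theorem hardy_halfspace {n : ℕ} [NeZero n] (hn : 2 ≤ n) (μ : ℝ) (hμ : μ ≤ 1 / 4) :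
    (∀ φ : EuclideanSpace ℝ (Fin n) → ℝ, IsTestFun (Hplus n) φ →
      (((n : ℝ) - 1 + Real.sqrt (1 - 4 * μ)) ^ 2 / 4) *
          ∫ x in Hplus n, (φ x) ^ 2 / ‖x‖ ^ 2 ≤
        (∫ x in Hplus n, ‖gradient φ x‖ ^ 2)
          - μ * ∫ x in Hplus n, (φ x) ^ 2 / (x 0) ^ 2) ∧
    (∀ φ : EuclideanSpace ℝ (Fin n) → ℝ, IsTestFun (Hplus n) φ →
      ((n : ℝ) ^ 2 / 4) * ∫ x in Hplus n, (φ x) ^ 2 / ‖x‖ ^ 2 ≤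
        ∫ x in Hplus n, ‖gradient φ x‖ ^ 2) ∧
    (∀ φ : EuclideanSpace ℝ (Fin n) → ℝ, IsTestFun (Hplus n) φ →
      (((n : ℝ) - 1) ^ 2 / 4) * ∫ x in Hplus n, (φ x) ^ 2 / ‖x‖ ^ 2 ≤
        (∫ x in Hplus n, ‖gradient φ x‖ ^ 2)
          - (1 / 4) * ∫ x in Hplus n, (φ x) ^ 2 / (x 0) ^ 2) := by
  have main : ∀ ν : ℝ, ν ≤ 1 / 4 → ∀ φ : EuclideanSpace ℝ (Fin n) → ℝ, IsTestFun (Hplus n) φ →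
      (((n : ℝ) - 1 + Real.sqrt (1 - 4 * ν)) ^ 2 / 4) *
          ∫ x in Hplus n, (φ x) ^ 2 / ‖x‖ ^ 2 ≤
        (∫ x in Hplus n, ‖gradient φ x‖ ^ 2)
          - ν * ∫ x in Hplus n, (φ x) ^ 2 / (x 0) ^ 2 := by
    intro ν hν φ hφ
    have hs := Real.sq_sqrt (show 0 ≤ 1 - 4 * ν by linarith)
    set s := Real.sqrt (1 - 4 * ν)
    have := hardy_general ((1 + s) / 2) (((n : ℝ) - 1 + s) / 2) φ hφ
    have e1 : (1 + s) / 2 * (1 - (1 + s) / 2) = ν := by linear_combination (-1 / 4) * hs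
    have e2 : ((n : ℝ) - 1 + s) / 2 * (2 * ((1 + s) / 2) + n - 2 - ((n : ℝ) - 1 + s) / 2)
        = ((n : ℝ) - 1 + s) ^ 2 / 4 := by ring
    rwa [e1, e2] at this
  refine ⟨main μ hμ, fun φ hφ => ?_, fun φ hφ => ?_⟩
  · simpa using main 0 (by norm_num) φ hφ
  · simpa using main (1 / 4) le_rfl φ hφ
end
end

section
/- Criticality of the optimal Hardy operator in the half-space (Theorem 6.1(1) and Theorem 6.2(3) for Ω = ℝⁿ₊): let n ≥ 2, μ ≤ 1/4 and η(μ) := n − 1 + √(1 − 4μ). For every measurable function W : ℝⁿ₊ → [0, ∞] that is strictly positive on a set of positive Lebesgue measure, there exists φ ∈ C_c^∞(ℝⁿ₊) such that ∫_{ℝⁿ₊} |∇φ|² dx − μ ∫_{ℝⁿ₊} φ²/x₁² dx < (η(μ)²/4) ∫_{ℝⁿ₊} φ²/|x|² dx + ∫_{ℝⁿ₊} W φ² dx. That is, the operator −Δ − μ/x₁² − η(μ)²/(4|x|²) is critical in ℝⁿ₊: the Hardy weight μ/x₁² + η(μ)²/(4|x|²) cannot be enlarged. -/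
open MeasureTheory
open scoped ENNReal

noncomputable section

lemma isOpen_Hplus (n : ℕ) [NeZero n] : IsOpen (Hplus n) := by
  have : Continuous fun x : EuclideanSpace ℝ (Fin n) => x 0 := by fun_prop
  exact isOpen_lt continuous_const this

lemma test_mul {n : ℕ} {Ω : Set (EuclideanSpace ℝ (Fin n))}
    {φ g : EuclideanSpace ℝ (Fin n) → ℝ} (h : IsTestFun Ω φ)
    (hg : ∀ x ∈ Ω, ContDiffAt ℝ (⊤ : ℕ∞) g x) : IsTestFun Ω (fun x => φ x * g x) := by
  refine ⟨?_, h.2.1.mul_right, (tsupport_mul_subset_left).trans h.2.2⟩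
  rw [contDiff_iff_contDiffAt]
  intro x
  by_cases hx : x ∈ tsupport φ
  · exact h.1.contDiffAt.mul (hg x (h.2.2 hx))
  · have : (fun x => φ x * g x) =ᶠ[nhds x] fun _ => 0 := by
      filter_upwards [notMem_tsupport_iff_eventuallyEq.mp hx] with y hy
      simp [hy]
    exact contDiffAt_const.congr_of_eventuallyEq this

lemma test_integrable {n : ℕ} {Ω : Set (EuclideanSpace ℝ (Fin n))}
    {φ : EuclideanSpace ℝ (Fin n) → ℝ} (h : IsTestFun Ω φ) : Integrable φ :=
  h.1.continuous.integrable_of_hasCompactSupport h.2.1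

lemma test_fderiv {n : ℕ} {Ω : Set (EuclideanSpace ℝ (Fin n))}
    {φ : EuclideanSpace ℝ (Fin n) → ℝ} (h : IsTestFun Ω φ) (v : EuclideanSpace ℝ (Fin n)) :
    IsTestFun Ω (fun x => fderiv ℝ φ x v) := by
  refine ⟨?_, h.2.1.fderiv_apply (𝕜 := ℝ) v, (tsupport_fderiv_apply_subset ℝ v).trans h.2.2⟩
  exact (h.1.fderiv_right (m := (⊤ : ℕ∞)) (by simp)).clm_apply contDiff_const

/-- the vector field of the ground state -/
def gsA {n : ℕ} [NeZero n] (α β : ℝ) (x : EuclideanSpace ℝ (Fin n)) :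
    EuclideanSpace ℝ (Fin n) :=
  (α / x 0) • EuclideanSpace.single 0 1 - (β / ‖x‖ ^ 2) • x

lemma Hplus_norm_pos {n : ℕ} [NeZero n] {x : EuclideanSpace ℝ (Fin n)} (hx : x ∈ Hplus n) :
    0 < ‖x‖ := by
  rw [norm_pos_iff]
  rintro rfl
  simp [Hplus] at hx

lemma gsA_apply {n : ℕ} [NeZero n] (α β : ℝ) (x : EuclideanSpace ℝ (Fin n)) (i : Fin n) :
    gsA α β x i = (if i = 0 then α else 0) * (x 0)⁻¹ - β * x i * (‖x‖ ^ 2)⁻¹ := by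
  simp [gsA, Pi.single_apply]
  split_ifs <;> ring

lemma coord_contDiff {n : ℕ} (i : Fin n) :
    ContDiff ℝ (⊤ : ℕ∞) (fun x : EuclideanSpace ℝ (Fin n) => x i) :=
  (EuclideanSpace.proj (𝕜 := ℝ) i : EuclideanSpace ℝ (Fin n) →L[ℝ] ℝ).contDiff

lemma inv_coord_contDiffAt {n : ℕ} [NeZero n] {x : EuclideanSpace ℝ (Fin n)} (hx : x ∈ Hplus n) :
    ContDiffAt ℝ (⊤ : ℕ∞) (fun x : EuclideanSpace ℝ (Fin n) => (x 0)⁻¹) x :=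
  (coord_contDiff 0).contDiffAt.inv (ne_of_gt hx)

lemma inv_normsq_contDiffAt {n : ℕ} [NeZero n] {x : EuclideanSpace ℝ (Fin n)} (hx : x ∈ Hplus n) :
    ContDiffAt ℝ (⊤ : ℕ∞) (fun x : EuclideanSpace ℝ (Fin n) => (‖x‖ ^ 2)⁻¹) x :=
  (contDiff_norm_sq ℝ).contDiffAt.inv (by have := Hplus_norm_pos hx; positivity)

lemma gsA_contDiffAt {n : ℕ} [NeZero n] (α β : ℝ) (i : Fin n)
    {x : EuclideanSpace ℝ (Fin n)} (hx : x ∈ Hplus n) :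
    ContDiffAt ℝ (⊤ : ℕ∞) (fun x => gsA α β x i) x := by
  simp_rw [gsA_apply]
  exact (contDiffAt_const.mul (inv_coord_contDiffAt hx)).sub
    ((contDiffAt_const.mul (coord_contDiff i).contDiffAt).mul (inv_normsq_contDiffAt hx))

lemma coord_hasFDerivAt {n : ℕ} (i : Fin n) (x : EuclideanSpace ℝ (Fin n)) :
    HasFDerivAt (fun x : EuclideanSpace ℝ (Fin n) => x i)
      (EuclideanSpace.proj (𝕜 := ℝ) i : EuclideanSpace ℝ (Fin n) →L[ℝ] ℝ) x :=
  (EuclideanSpace.proj (𝕜 := ℝ) i : EuclideanSpace ℝ (Fin n) →L[ℝ] ℝ).hasFDerivAt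

lemma gsA_fderiv {n : ℕ} [NeZero n] (α β : ℝ) (i : Fin n)
    {x : EuclideanSpace ℝ (Fin n)} (hx : x ∈ Hplus n) :
    fderiv ℝ (fun x => gsA α β x i) x (EuclideanSpace.single i 1) =
      - (if i = 0 then α else 0) / (x 0) ^ 2 - β / ‖x‖ ^ 2 + 2 * β * (x i) ^ 2 / ‖x‖ ^ 4 := by
  have h0 : x 0 ≠ 0 := ne_of_gt hx
  have h1 := Hplus_norm_pos hx
  have e1 := (hasFDerivAt_inv h0).comp x (coord_hasFDerivAt 0 x)
  have hN : ‖x‖ ^ 2 ≠ 0 := by positivity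
  have e2 := (hasFDerivAt_inv hN).comp x (hasFDerivAt_id x).norm_sq
  have e4 : HasFDerivAt (fun y : EuclideanSpace ℝ (Fin n) => β * y i)
      (β • (EuclideanSpace.proj (𝕜 := ℝ) i : EuclideanSpace ℝ (Fin n) →L[ℝ] ℝ)) x :=
    HasFDerivAt.const_mul (coord_hasFDerivAt i x) β
  have e3 := ((e1.const_mul (if i = 0 then α else 0))).sub (e4.mul e2)
  have e5 : (fun x => gsA α β x i) = (fun x : EuclideanSpace ℝ (Fin n) =>
      (if i = 0 then α else 0) * (x 0)⁻¹ - β * x i * (‖x‖ ^ 2)⁻¹) := by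
    funext y; exact gsA_apply α β y i
  rw [e5]
  refine (congrArg (fun L => L (EuclideanSpace.single i 1)) (HasFDerivAt.fderiv e3)).trans ?_
  by_cases hi : i = 0
  · subst hi
    simp [EuclideanSpace.inner_single_right]
    field_simp
    ring
  · simp [hi, EuclideanSpace.inner_single_right]
    field_simp

lemma gradient_apply' {n : ℕ} (φ : EuclideanSpace ℝ (Fin n) → ℝ) (x : EuclideanSpace ℝ (Fin n))
    (i : Fin n) : gradient φ x i = fderiv ℝ φ x (EuclideanSpace.single i 1) := by
  have := congrArg (fun L => L (EuclideanSpace.single i 1))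
    (toDual_gradient (𝕜 := ℝ) (f := φ) (x := x))
  rw [← this]
  simp only [InnerProductSpace.toDual_apply_apply]
  rw [EuclideanSpace.inner_single_right]
  simp

lemma energy_identity {n : ℕ} [NeZero n] (α β μ : ℝ) (h1 : α ^ 2 - α = -μ)
    (h2 : 2 * β = n - 2 + 2 * α) {φ : EuclideanSpace ℝ (Fin n) → ℝ} (h : IsTestFun (Hplus n) φ) :
    (∫ x in Hplus n, ‖gradient φ x‖ ^ 2) - μ * (∫ x in Hplus n, (φ x) ^ 2 / (x 0) ^ 2)
      - β ^ 2 * (∫ x in Hplus n, (φ x) ^ 2 / ‖x‖ ^ 2)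
      = ∫ x in Hplus n, ‖gradient φ x - φ x • gsA α β x‖ ^ 2 := by
  have hD := fun i : Fin n => test_fderiv h (EuclideanSpace.single i 1)
  have hG := fun i : Fin n => test_mul h (fun x hx => gsA_contDiffAt α β i hx)
  have hDG := fun i : Fin n => test_fderiv (hG i) (EuclideanSpace.single i 1)
  have ibp : ∀ i : Fin n, ∫ x, φ x * fderiv ℝ (fun x => φ x * gsA α β x i) x
      (EuclideanSpace.single i 1) = - ∫ x, fderiv ℝ φ x (EuclideanSpace.single i 1) *
        (φ x * gsA α β x i) := by
    intro i
    apply integral_mul_fderiv_eq_neg_fderiv_mul_of_integrable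
    · exact test_integrable (test_mul (hD i) fun x hx => (hG i).1.contDiffAt)
    · exact test_integrable (test_mul h fun x hx => (hDG i).1.contDiffAt)
    · exact test_integrable (test_mul h fun x hx => (hG i).1.contDiffAt)
    · intro x _; exact h.1.contDiffAt.differentiableAt (by simp)
    · intro x _; exact (hG i).1.contDiffAt.differentiableAt (by simp)
  have i1 := fun i => test_integrable (test_mul h fun x hx => (hDG i).1.contDiffAt)
  have i2 := fun i => test_integrable (test_mul (hD i) fun x hx => (hG i).1.contDiffAt)
  have hdiv : ∫ x in Hplus n, ∑ i, (φ x * fderiv ℝ (fun x => φ x * gsA α β x i) x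
      (EuclideanSpace.single i 1) + fderiv ℝ φ x (EuclideanSpace.single i 1) *
        (φ x * gsA α β x i)) = 0 := by
    rw [setIntegral_eq_integral_of_forall_compl_eq_zero]
    · rw [integral_finsetSum]
      · apply Finset.sum_eq_zero
        intro i _
        rw [integral_add (i1 i) (i2 i), ibp i]; ring
      · intro i _; exact (i1 i).add (i2 i)
    · intro x hx
      have : φ x = 0 := by
        by_contra hne; exact hx (h.2.2 (subset_tsupport _ hne))
      simp [this]
  have j0 : Integrable (fun x => ‖gradient φ x‖ ^ 2) := by
    simp_rw [EuclideanSpace.real_norm_sq_eq, gradient_apply', pow_two]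
    apply integrable_finsetSum
    intro i _
    exact test_integrable (test_mul (hD i) fun x hx => (hD i).1.contDiffAt)
  have j1 : Integrable (fun x => (φ x) ^ 2 / (x 0) ^ 2) := by
    have := test_integrable (test_mul h fun x hx => (h.1.contDiffAt (x := x)).mul
      ((inv_coord_contDiffAt hx).pow 2))
    refine this.congr (Filter.Eventually.of_forall fun x => ?_)
    simp only [Pi.mul_apply, Pi.pow_apply]; ring
  have j2 : Integrable (fun x => (φ x) ^ 2 / ‖x‖ ^ 2) := by
    have := test_integrable (test_mul h fun x hx => (h.1.contDiffAt (x := x)).mul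
      (inv_normsq_contDiffAt hx))
    refine this.congr (Filter.Eventually.of_forall fun x => ?_)
    simp only [Pi.mul_apply]; ring
  have j3 : Integrable (fun x => ∑ i, (φ x * fderiv ℝ (fun x => φ x * gsA α β x i) x
      (EuclideanSpace.single i 1) + fderiv ℝ φ x (EuclideanSpace.single i 1) *
        (φ x * gsA α β x i))) := integrable_finsetSum _ fun i _ => (i1 i).add (i2 i)
  have key : ∫ x in Hplus n, ‖gradient φ x - φ x • gsA α β x‖ ^ 2 =
      ∫ x in Hplus n, (((‖gradient φ x‖ ^ 2 - μ * ((φ x) ^ 2 / (x 0) ^ 2)) -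
        β ^ 2 * ((φ x) ^ 2 / ‖x‖ ^ 2)) - ∑ i, (φ x * fderiv ℝ (fun x => φ x * gsA α β x i) x
      (EuclideanSpace.single i 1) + fderiv ℝ φ x (EuclideanSpace.single i 1) *
        (φ x * gsA α β x i))) := by
    apply setIntegral_congr_fun (isOpen_Hplus n).measurableSet
    intro x hx
    have h0 : x 0 ≠ 0 := ne_of_gt hx
    have hN := Hplus_norm_pos hx
    have hfd : ∀ i, fderiv ℝ (fun x => φ x * gsA α β x i) x (EuclideanSpace.single i 1) =
        φ x * (- (if i = 0 then α else 0) / (x 0) ^ 2 - β / ‖x‖ ^ 2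
          + 2 * β * (x i) ^ 2 / ‖x‖ ^ 4) + gsA α β x i * gradient φ x i := by
      intro i
      rw [fderiv_fun_mul (h.1.contDiffAt.differentiableAt (by simp))
        ((gsA_contDiffAt α β i hx).differentiableAt (by simp)), gradient_apply', ← gsA_fderiv α β i hx]
      simp
    have hNs : ∑ i, (x i) ^ 2 = ‖x‖ ^ 2 := (EuclideanSpace.real_norm_sq_eq x).symm
    have sA : ∑ i, (gsA α β x i) ^ 2 = α ^ 2 / (x 0) ^ 2 - 2 * α * β / ‖x‖ ^ 2
        + β ^ 2 / ‖x‖ ^ 2 := by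
      have : ∀ i, (gsA α β x i) ^ 2 = (if i = 0 then α ^ 2 / (x 0) ^ 2 - 2 * α * β / ‖x‖ ^ 2 else 0)
          + β ^ 2 / ‖x‖ ^ 4 * (x i) ^ 2 := by
        intro i
        rw [gsA_apply]
        by_cases hi : i = 0
        · subst hi; simp; field_simp; ring
        · simp [hi]; field_simp
      simp_rw [this, Finset.sum_add_distrib, ← Finset.mul_sum, hNs]
      simp
      field_simp
    have sD : ∑ i, (- (if i = 0 then α else 0) / (x 0) ^ 2 - β / ‖x‖ ^ 2
          + 2 * β * (x i) ^ 2 / ‖x‖ ^ 4 : ℝ) = - α / (x 0) ^ 2 - n * β / ‖x‖ ^ 2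
          + 2 * β / ‖x‖ ^ 2 := by
      have : ∀ i, (- (if i = 0 then α else 0) / (x 0) ^ 2 - β / ‖x‖ ^ 2
          + 2 * β * (x i) ^ 2 / ‖x‖ ^ 4 : ℝ) = (if i = 0 then - α / (x 0) ^ 2 else 0) - β / ‖x‖ ^ 2
          + 2 * β / ‖x‖ ^ 4 * (x i) ^ 2 := by
        intro i
        by_cases hi : i = 0
        · subst hi; simp; ring
        · simp [hi]; ring
      simp_rw [this, Finset.sum_add_distrib, Finset.sum_sub_distrib, ← Finset.mul_sum, hNs]
      simp
      field_simp
    have L : ‖gradient φ x - φ x • gsA α β x‖ ^ 2 = ‖gradient φ x‖ ^ 2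
        - 2 * φ x * ∑ i, gsA α β x i * gradient φ x i + (φ x) ^ 2 * ∑ i, (gsA α β x i) ^ 2 := by
      simp_rw [EuclideanSpace.real_norm_sq_eq, Finset.mul_sum, ← Finset.sum_sub_distrib,
        ← Finset.sum_add_distrib]
      apply Finset.sum_congr rfl
      intro i _
      simp
      ring
    have R : ∑ i, (φ x * fderiv ℝ (fun x => φ x * gsA α β x i) x
      (EuclideanSpace.single i 1) + fderiv ℝ φ x (EuclideanSpace.single i 1) *
        (φ x * gsA α β x i)) = 2 * φ x * ∑ i, gsA α β x i * gradient φ x i +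
        (φ x) ^ 2 * ∑ i, (- (if i = 0 then α else 0) / (x 0) ^ 2 - β / ‖x‖ ^ 2
          + 2 * β * (x i) ^ 2 / ‖x‖ ^ 4 : ℝ) := by
      simp_rw [Finset.mul_sum, ← Finset.sum_add_distrib]
      apply Finset.sum_congr rfl
      intro i _
      rw [hfd i, ← gradient_apply']
      ring
    simp only
    rw [L, R, sA, sD]
    have hμ : μ = α - α ^ 2 := by linarith
    have hn : (n : ℝ) = 2 * β + 2 - 2 * α := by linarith
    rw [hμ, hn]
    field_simp
    ring
  have a1 := j0.integrableOn (s := Hplus n)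
  have a2 := j1.integrableOn (s := Hplus n)
  have a3 := j2.integrableOn (s := Hplus n)
  have a4 := j3.integrableOn (s := Hplus n)
  have b2 : IntegrableOn (fun x => μ * ((φ x) ^ 2 / (x 0) ^ 2)) (Hplus n) := a2.const_mul μ
  have b3 : IntegrableOn (fun x => β ^ 2 * ((φ x) ^ 2 / ‖x‖ ^ 2)) (Hplus n) := a3.const_mul _
  have b4 : IntegrableOn (fun x => ‖gradient φ x‖ ^ 2 - μ * ((φ x) ^ 2 / (x 0) ^ 2)) (Hplus n) :=
    a1.sub b2
  have b5 : IntegrableOn (fun x => ‖gradient φ x‖ ^ 2 - μ * ((φ x) ^ 2 / (x 0) ^ 2)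
      - β ^ 2 * ((φ x) ^ 2 / ‖x‖ ^ 2)) (Hplus n) := b4.sub b3
  rw [key, integral_sub b5 a4, hdiv, integral_sub b4 b3, integral_sub a1 b2,
    integral_const_mul, integral_const_mul, sub_zero]

lemma exists_bump : ∃ (b : ℝ → ℝ) (C : ℝ), ContDiff ℝ (⊤ : ℕ∞) b ∧ (∀ t, 0 ≤ b t) ∧ (∀ t, b t ≤ 1) ∧
    (∀ t, |t| ≤ 1 → b t = 1) ∧ (∀ t, 2 < |t| → b t = 0) ∧ (∀ t, |deriv b t| ≤ C) ∧
    (∀ t, 2 < |t| → deriv b t = 0) := by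
  let B : ContDiffBump (0 : ℝ) := ⟨1, 2, by norm_num, by norm_num⟩
  have hB : ContDiff ℝ (⊤ : ℕ∞) B := B.contDiff
  have hc : Continuous (deriv B) := hB.continuous_deriv (by simp)
  obtain ⟨C, hC⟩ := B.hasCompactSupport.deriv.exists_bound_of_continuous hc
  have h0 : ∀ t, 2 < |t| → B t = 0 := fun t ht => B.zero_of_le_dist (by simpa [B] using ht.le)
  refine ⟨B, C, hB, fun t => B.nonneg, fun t => B.le_one, ?_, h0, hC, ?_⟩
  · intro t ht
    exact B.one_of_mem_closedBall (by simpa [B] using ht)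
  · intro t ht
    have : (B : ℝ → ℝ) =ᶠ[nhds t] fun _ => 0 := by
      filter_upwards [(isOpen_lt continuous_const continuous_abs).mem_nhds ht] with s hs
      exact h0 s hs
    rw [this.deriv_eq]; simp

/-- the cut-off ground state -/
def tf {n : ℕ} [NeZero n] (b : ℝ → ℝ) (α β k m : ℝ) (x : EuclideanSpace ℝ (Fin n)) : ℝ :=
  if 0 < x 0 then Real.exp (α * Real.log (x 0) - β * Real.log ‖x‖) * b (Real.log ‖x‖ / k)
    * b (Real.log (x 0) / m) else 0

lemma coord_le_norm {n : ℕ} (x : EuclideanSpace ℝ (Fin n)) (i : Fin n) : |x i| ≤ ‖x‖ := by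
  simpa using PiLp.norm_apply_le x i

lemma tf_eventually {n : ℕ} [NeZero n] (b : ℝ → ℝ) (α β k m : ℝ) {x : EuclideanSpace ℝ (Fin n)}
    (hx : x ∈ Hplus n) : tf b α β k m =ᶠ[nhds x] fun x =>
    Real.exp (α * Real.log (x 0) - β * Real.log ‖x‖) * b (Real.log ‖x‖ / k)
    * b (Real.log (x 0) / m) := by
  filter_upwards [(isOpen_Hplus n).mem_nhds hx] with y hy
  have : 0 < y 0 := hy
  simp [tf, this]

lemma tf_test {n : ℕ} [NeZero n] {b : ℝ → ℝ} (hb : ContDiff ℝ (⊤ : ℕ∞) b)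
    (hb0 : ∀ t, 2 < |t| → b t = 0) (α β : ℝ) {k m : ℝ} (hk : 0 < k) (hm : 0 < m) :
    IsTestFun (Hplus n) (tf b α β k m) := by
  let K : Set (EuclideanSpace ℝ (Fin n)) :=
    {x | Real.exp (-2 * m) ≤ x 0} ∩ Metric.closedBall 0 (Real.exp (2 * k))
  have hKc : IsClosed {x : EuclideanSpace ℝ (Fin n) | Real.exp (-2 * m) ≤ x 0} :=
    isClosed_le continuous_const (coord_contDiff (n := n) 0).continuous
  have hK : IsCompact K := (isCompact_closedBall 0 _).inter_left hKc
  have hsup : Function.support (tf b α β k m) ⊆ K := by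
    intro x hx
    have hx0 : 0 < x 0 := by
      by_contra hne
      exact hx (by simp [tf, hne])
    have hN : 0 < ‖x‖ := Hplus_norm_pos hx0
    have h1 : |Real.log ‖x‖ / k| ≤ 2 := by
      by_contra! hne
      exact hx (by simp [tf, hb0 _ hne])
    have h2 : |Real.log (x 0) / m| ≤ 2 := by
      by_contra! hne
      exact hx (by simp [tf, hb0 _ hne])
    rw [abs_le, le_div_iff₀ hk, div_le_iff₀ hk] at h1
    rw [abs_le, le_div_iff₀ hm, div_le_iff₀ hm] at h2
    refine ⟨?_, ?_⟩
    · exact (Real.le_log_iff_exp_le hx0).mp h2.1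
    · simpa using (Real.log_le_iff_le_exp hN).mp h1.2
  have hts : tsupport (tf b α β k m) ⊆ K := closure_minimal hsup hK.isClosed
  have hKH : K ⊆ Hplus n := fun x hx => lt_of_lt_of_le (Real.exp_pos _) hx.1
  refine ⟨?_, HasCompactSupport.of_support_subset_isCompact hK hsup, hts.trans hKH⟩
  rw [contDiff_iff_contDiffAt]
  intro x
  by_cases hx : x ∈ tsupport (tf b α β k m)
  · have hxH := hKH (hts hx)
    have hN := Hplus_norm_pos hxH
    refine ContDiffAt.congr_of_eventuallyEq ?_ (tf_eventually b α β k m hxH)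
    have c1 : ContDiffAt ℝ (⊤ : ℕ∞) (fun x : EuclideanSpace ℝ (Fin n) => Real.log (x 0)) x :=
      (coord_contDiff 0).contDiffAt.log (ne_of_gt hxH)
    have c2 : ContDiffAt ℝ (⊤ : ℕ∞) (fun x : EuclideanSpace ℝ (Fin n) => Real.log ‖x‖) x :=
      (contDiffAt_norm ℝ (norm_pos_iff.mp hN)).log hN.ne'
    exact (((contDiffAt_const.mul c1).sub (contDiffAt_const.mul c2)).exp.mul
      (hb.contDiffAt.comp x (c2.div_const k))).mul (hb.contDiffAt.comp x (c1.div_const m))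
  · have : tf b α β k m =ᶠ[nhds x] fun _ => 0 := notMem_tsupport_iff_eventuallyEq.mp hx
    exact contDiffAt_const.congr_of_eventuallyEq this

lemma tf_grad {n : ℕ} [NeZero n] {b : ℝ → ℝ} (hb : ContDiff ℝ (⊤ : ℕ∞) b)
    (α β k m : ℝ) {x : EuclideanSpace ℝ (Fin n)} (hx : x ∈ Hplus n) :
    gradient (tf b α β k m) x - tf b α β k m x • gsA α β x =
      (Real.exp (α * Real.log (x 0) - β * Real.log ‖x‖) *
        (deriv b (Real.log ‖x‖ / k) / k * b (Real.log (x 0) / m)) / ‖x‖ ^ 2) • x +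
      (Real.exp (α * Real.log (x 0) - β * Real.log ‖x‖) *
        (b (Real.log ‖x‖ / k) * (deriv b (Real.log (x 0) / m) / m)) / x 0) •
          EuclideanSpace.single 0 1 := by
  have hx0 : 0 < x 0 := hx
  have hN := Hplus_norm_pos hx
  have hd : ∀ t, HasDerivAt b (deriv b t) t := fun t =>
    (hb.contDiffAt.differentiableAt (by simp)).hasDerivAt
  have c1 : HasFDerivAt (fun x : EuclideanSpace ℝ (Fin n) => Real.log (x 0))
      ((x 0)⁻¹ • (EuclideanSpace.proj (𝕜 := ℝ) 0 : EuclideanSpace ℝ (Fin n) →L[ℝ] ℝ)) x :=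
    (coord_hasFDerivAt 0 x).log hx0.ne'
  have c2 : HasFDerivAt (fun x : EuclideanSpace ℝ (Fin n) => Real.log ‖x‖)
      ((‖x‖ ^ 2)⁻¹ • (innerSL ℝ x)) x := by
    have e := (((hasFDerivAt_id x).norm_sq.log (by simpa using hN.ne')).const_mul (1/2 : ℝ))
    have e' : (fun x : EuclideanSpace ℝ (Fin n) => Real.log ‖x‖) =
        fun x => (1/2 : ℝ) * Real.log (‖x‖ ^ 2) := by
      funext y; rw [Real.log_pow]; push_cast; ring
    rw [e']
    refine HasFDerivAt.congr_fderiv e ?_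
    ext v
    simp
    ring
  have d1 := (hd (Real.log (x 0) / m)).comp_hasFDerivAt x (c1.mul_const m⁻¹)
  have d2 := (hd (Real.log ‖x‖ / k)).comp_hasFDerivAt x (c2.mul_const k⁻¹)
  have d3 := ((c1.const_mul α).sub (c2.const_mul β)).exp
  have d4 := (d3.mul d2).mul d1
  have d5 := HasFDerivAt.congr_of_eventuallyEq d4 (tf_eventually b α β k m hx)
  have hg : HasGradientAt (tf b α β k m) (tf b α β k m x • gsA α β x +
      ((Real.exp (α * Real.log (x 0) - β * Real.log ‖x‖) *
        (deriv b (Real.log ‖x‖ / k) / k * b (Real.log (x 0) / m)) / ‖x‖ ^ 2) • x +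
      (Real.exp (α * Real.log (x 0) - β * Real.log ‖x‖) *
        (b (Real.log ‖x‖ / k) * (deriv b (Real.log (x 0) / m) / m)) / x 0) •
          EuclideanSpace.single 0 1)) x := by
    rw [hasGradientAt_iff_hasFDerivAt]
    refine HasFDerivAt.congr_fderiv d5 ?_
    ext v
    have : tf b α β k m x = Real.exp (α * Real.log (x 0) - β * Real.log ‖x‖)
      * b (Real.log ‖x‖ / k) * b (Real.log (x 0) / m) := by simp [tf, hx0]
    rw [this]
    simp [gsA, inner_add_left, inner_sub_left, inner_smul_left, EuclideanSpace.inner_single_left,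
      div_eq_mul_inv]
    ring
  rw [hg.gradient]
  abel

lemma tf_bound {n : ℕ} [NeZero n] {b : ℝ → ℝ} {C : ℝ} (hb : ContDiff ℝ (⊤ : ℕ∞) b)
    (hb1 : ∀ t, 0 ≤ b t) (hb2 : ∀ t, b t ≤ 1) (hb0 : ∀ t, 2 < |t| → b t = 0)
    (hC : ∀ t, |deriv b t| ≤ C) (hC0 : ∀ t, 2 < |t| → deriv b t = 0)
    {α β k m : ℝ} (hα : 1 / 2 ≤ α) (h2 : 2 * β = n - 2 + 2 * α) (hk : 0 < k) (hm : 0 < m)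
    {x : EuclideanSpace ℝ (Fin n)} (hx : x ∈ Hplus n) :
    ‖gradient (tf b α β k m) x - tf b α β k m x • gsA α β x‖ ^ 2 ≤
      2 * C ^ 2 / k ^ 2 * (Set.Icc (Real.exp (-2 * k)) (Real.exp (2 * k))).indicator
        (fun y => (y ^ n)⁻¹) ‖x‖ +
      2 * C ^ 2 / m ^ 2 * Real.exp (2 * k * (n - 1)) *
        ∏ i, (if i = 0 then (Set.Icc (Real.exp (-2 * m)) (Real.exp (2 * m))).indicator
          (fun y => y⁻¹) else (Set.Icc (-Real.exp (2 * k)) (Real.exp (2 * k))).indicator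
            (fun _ => (1 : ℝ))) (x i) := by
  have hx0 : 0 < x 0 := hx
  have hN := Hplus_norm_pos hx
  rw [tf_grad hb α β k m hx]
  set p := Real.log (x 0) with hp
  set q := Real.log ‖x‖ with hq
  have ep : Real.exp p = x 0 := Real.exp_log hx0
  have eq : Real.exp q = ‖x‖ := Real.exp_log hN
  have hpq : p ≤ q := Real.log_le_log hx0 ((le_abs_self _).trans (coord_le_norm x 0))
  have hn1 : (1 : ℝ) ≤ n := by exact_mod_cast NeZero.one_le
  have hCn : 0 ≤ C := (abs_nonneg _).trans (hC 0)
  set u := (Real.exp (α * p - β * q) * (deriv b (q / k) / k * b (p / m)) / ‖x‖ ^ 2) • x with hu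
  set v := (Real.exp (α * p - β * q) * (b (q / k) * (deriv b (p / m) / m)) / x 0) •
          (EuclideanSpace.single 0 1 : EuclideanSpace ℝ (Fin n)) with hv
  have huv : ‖u + v‖ ^ 2 ≤ 2 * ‖u‖ ^ 2 + 2 * ‖v‖ ^ 2 := by
    have := norm_add_le u v
    nlinarith [sq_nonneg (‖u‖ - ‖v‖), norm_nonneg (u + v), norm_nonneg u, norm_nonneg v]
  have hu2 : ‖u‖ ^ 2 = Real.exp (2 * α * p - 2 * β * q - 2 * q) *
      ((deriv b (q / k)) ^ 2 * (b (p / m)) ^ 2) / k ^ 2 := by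
    rw [hu, norm_smul, mul_pow, Real.norm_eq_abs, sq_abs]
    have : Real.exp (2 * α * p - 2 * β * q - 2 * q) = Real.exp (α * p - β * q) ^ 2 / ‖x‖ ^ 2 := by
      rw [← eq, ← Real.exp_nat_mul, ← Real.exp_nat_mul, ← Real.exp_sub]
      congr 1; push_cast; ring
    rw [this]
    field_simp
  have hv2 : ‖v‖ ^ 2 = Real.exp (2 * α * p - 2 * β * q - 2 * p) *
      ((b (q / k)) ^ 2 * (deriv b (p / m)) ^ 2) / m ^ 2 := by
    rw [hv, norm_smul, mul_pow, Real.norm_eq_abs, sq_abs]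
    have : Real.exp (2 * α * p - 2 * β * q - 2 * p) = Real.exp (α * p - β * q) ^ 2 / x 0 ^ 2 := by
      rw [← ep, ← Real.exp_nat_mul, ← Real.exp_nat_mul, ← Real.exp_sub]
      congr 1; push_cast; ring
    rw [this]
    simp
    field_simp
  have hbsq : ∀ t, b t ^ 2 ≤ 1 := fun t => pow_le_one₀ (hb1 t) (hb2 t)
  have hdsq : ∀ t, deriv b t ^ 2 ≤ C ^ 2 := fun t => sq_le_sq' (abs_le.mp (hC t)).1 (abs_le.mp (hC t)).2
  have U : ‖u‖ ^ 2 ≤ C ^ 2 / k ^ 2 * (Set.Icc (Real.exp (-2 * k)) (Real.exp (2 * k))).indicator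
        (fun y => (y ^ n)⁻¹) ‖x‖ := by
    by_cases hq2 : 2 < |q / k|
    · rw [hu2, hC0 _ hq2]
      have : 0 ≤ (Set.Icc (Real.exp (-2 * k)) (Real.exp (2 * k))).indicator
        (fun y => (y ^ n)⁻¹) ‖x‖ := Set.indicator_apply_nonneg fun _ => by positivity
      simp only [ne_eq, OfNat.ofNat_ne_zero, not_false_eq_true, zero_pow, zero_mul, mul_zero,
        zero_div]
      positivity
    · rw [not_lt, abs_le, le_div_iff₀ hk, div_le_iff₀ hk] at hq2
      rw [Set.indicator_of_mem (by
        rw [Set.mem_Icc, ← eq, Real.exp_le_exp, Real.exp_le_exp]; exact hq2), hu2]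
      have e1 : Real.exp (2 * α * p - 2 * β * q - 2 * q) ≤ (‖x‖ ^ n)⁻¹ := by
        rw [← eq, ← Real.exp_nat_mul, ← Real.exp_neg, Real.exp_le_exp]
        nlinarith
      calc _ ≤ (‖x‖ ^ n)⁻¹ * (C ^ 2 * 1) / k ^ 2 := by
            gcongr ?_ * ?_ / _
            exact mul_le_mul (hdsq _) (hbsq _) (sq_nonneg _) (sq_nonneg _)
        _ = _ := by ring
  have V : ‖v‖ ^ 2 ≤ C ^ 2 / m ^ 2 * Real.exp (2 * k * (n - 1)) *
        ∏ i, (if i = 0 then (Set.Icc (Real.exp (-2 * m)) (Real.exp (2 * m))).indicator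
          (fun y => y⁻¹) else (Set.Icc (-Real.exp (2 * k)) (Real.exp (2 * k))).indicator
            (fun _ => (1 : ℝ))) (x i) := by
    by_cases hz : b (q / k) ^ 2 * deriv b (p / m) ^ 2 = 0
    · rw [hv2, hz, mul_zero, zero_div]
      refine mul_nonneg (by positivity) (Finset.prod_nonneg fun i _ => ?_)
      split_ifs with hi
      · subst hi
        exact Set.indicator_apply_nonneg fun _ => by positivity
      · exact Set.indicator_apply_nonneg fun _ => by positivity
    · have hq2 : |q / k| ≤ 2 := by
        by_contra! hne; exact hz (by simp [hb0 _ hne])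
      have hp2 : |p / m| ≤ 2 := by
        by_contra! hne; exact hz (by simp [hC0 _ hne])
      rw [abs_le, le_div_iff₀ hk, div_le_iff₀ hk] at hq2
      rw [abs_le, le_div_iff₀ hm, div_le_iff₀ hm] at hp2
      have hprod : ∏ i, (if i = 0 then (Set.Icc (Real.exp (-2 * m)) (Real.exp (2 * m))).indicator
          (fun y => y⁻¹) else (Set.Icc (-Real.exp (2 * k)) (Real.exp (2 * k))).indicator
            (fun _ => (1 : ℝ))) (x i) = (x 0)⁻¹ := by
        rw [Finset.prod_eq_single 0]
        · rw [if_pos rfl, Set.indicator_of_mem]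
          rw [Set.mem_Icc, ← ep, Real.exp_le_exp, Real.exp_le_exp]; exact hp2
        · intro i _ hi
          rw [if_neg hi, Set.indicator_of_mem]
          have : ‖x‖ ≤ Real.exp (2 * k) := by rw [← eq, Real.exp_le_exp]; exact hq2.2
          exact abs_le.mp ((coord_le_norm x i).trans this)
        · simp
      rw [hprod, hv2]
      have e1 : Real.exp (2 * α * p - 2 * β * q - 2 * p) ≤ Real.exp (2 * k * (n - 1)) * (x 0)⁻¹ := by
        rw [← ep, ← Real.exp_neg, ← Real.exp_add, Real.exp_le_exp]
        nlinarith [mul_nonneg (by linarith : 0 ≤ 2 * α - 1) (sub_nonneg.mpr hpq),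
          mul_nonneg (sub_nonneg.mpr hn1) (by linarith : 0 ≤ 2 * k + q)]
      calc _ ≤ (Real.exp (2 * k * (n - 1)) * (x 0)⁻¹) * (1 * C ^ 2) / m ^ 2 := by
            gcongr ?_ * ?_ / _
            exact mul_le_mul (hbsq _) (hdsq _) (sq_nonneg _) zero_le_one
        _ = _ := by ring
  calc _ ≤ _ := huv
    _ ≤ _ := add_le_add (mul_le_mul_of_nonneg_left U zero_le_two) (mul_le_mul_of_nonneg_left V zero_le_two)
    _ = _ := by ring

lemma int_inv_Icc {m : ℝ} (hm : 0 < m) :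
    Integrable ((Set.Icc (Real.exp (-2 * m)) (Real.exp (2 * m))).indicator fun y : ℝ => y⁻¹) ∧
    ∫ y, (Set.Icc (Real.exp (-2 * m)) (Real.exp (2 * m))).indicator (fun y : ℝ => y⁻¹) y
      = 4 * m := by
  have hle : Real.exp (-2 * m) ≤ Real.exp (2 * m) := Real.exp_le_exp.mpr (by linarith)
  constructor
  · rw [integrable_indicator_iff measurableSet_Icc]
    apply ContinuousOn.integrableOn_compact isCompact_Icc
    apply continuousOn_inv₀.mono
    intro y hy
    exact (lt_of_lt_of_le (Real.exp_pos _) hy.1).ne'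
  · rw [integral_indicator measurableSet_Icc, integral_Icc_eq_integral_Ioc,
      ← intervalIntegral.integral_of_le hle, integral_inv_of_pos (Real.exp_pos _) (Real.exp_pos _),
      ← Real.exp_sub, Real.log_exp]
    ring

lemma int_radial {n : ℕ} [NeZero n] {k : ℝ} (hk : 0 < k) :
    Integrable (fun x : EuclideanSpace ℝ (Fin n) =>
      (Set.Icc (Real.exp (-2 * k)) (Real.exp (2 * k))).indicator (fun y => (y ^ n)⁻¹) ‖x‖) ∧
    ∫ x : EuclideanSpace ℝ (Fin n),
      (Set.Icc (Real.exp (-2 * k)) (Real.exp (2 * k))).indicator (fun y => (y ^ n)⁻¹) ‖x‖ =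
      n * (volume : Measure (EuclideanSpace ℝ (Fin n))).real (Metric.ball 0 1) * (4 * k) := by
  have hn1 : 1 ≤ n := NeZero.one_le
  have hnt : Nontrivial (EuclideanSpace ℝ (Fin n)) := by
    refine ⟨EuclideanSpace.single 0 1, 0, ?_⟩
    intro h
    have := congrArg (fun x : EuclideanSpace ℝ (Fin n) => x 0) h
    simp at this
  have heq : ∀ y ∈ Set.Ioi (0 : ℝ), y ^ (n - 1) •
      (Set.Icc (Real.exp (-2 * k)) (Real.exp (2 * k))).indicator (fun y => (y ^ n)⁻¹) y =
      (Set.Icc (Real.exp (-2 * k)) (Real.exp (2 * k))).indicator (fun y : ℝ => y⁻¹) y := by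
    intro y hy
    have hy0 : 0 < y := hy
    by_cases h : y ∈ Set.Icc (Real.exp (-2 * k)) (Real.exp (2 * k))
    · rw [Set.indicator_of_mem h, Set.indicator_of_mem h, smul_eq_mul]
      obtain ⟨l, rfl⟩ : ∃ l, n = l + 1 := ⟨n - 1, by omega⟩
      simp only [Nat.add_sub_cancel, pow_succ]
      field_simp
    · rw [Set.indicator_of_notMem h, Set.indicator_of_notMem h, smul_zero]
  constructor
  · rw [integrable_fun_norm_addHaar volume, finrank_euclideanSpace, Fintype.card_fin]
    exact ((int_inv_Icc hk).1.integrableOn).congr_fun (fun y hy => (heq y hy).symm)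
      measurableSet_Ioi
  · rw [integral_fun_norm_addHaar volume, finrank_euclideanSpace, Fintype.card_fin,
      setIntegral_congr_fun measurableSet_Ioi heq, ← (int_inv_Icc hk).2]
    rw [setIntegral_eq_integral_of_forall_compl_eq_zero]
    · simp; ring
    · intro y hy
      rw [Set.indicator_of_notMem]
      intro h
      exact hy (lt_of_lt_of_le (Real.exp_pos _) h.1)

lemma int_box {n : ℕ} [NeZero n] (k : ℝ) : ∃ D : ℝ, 0 ≤ D ∧ ∀ m : ℝ, 0 < m →
    Integrable (fun x : EuclideanSpace ℝ (Fin n) =>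
      ∏ i, (if i = 0 then (Set.Icc (Real.exp (-2 * m)) (Real.exp (2 * m))).indicator
          (fun y => y⁻¹) else (Set.Icc (-Real.exp (2 * k)) (Real.exp (2 * k))).indicator
            (fun _ => (1 : ℝ))) (x i)) ∧
    ∫ x : EuclideanSpace ℝ (Fin n),
      ∏ i, (if i = 0 then (Set.Icc (Real.exp (-2 * m)) (Real.exp (2 * m))).indicator
          (fun y => y⁻¹) else (Set.Icc (-Real.exp (2 * k)) (Real.exp (2 * k))).indicator
            (fun _ => (1 : ℝ))) (x i) = 4 * m * D := by
  let g : ℝ → ℝ := (Set.Icc (-Real.exp (2 * k)) (Real.exp (2 * k))).indicator (fun _ => (1 : ℝ))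
  have hg : Integrable g := by
    rw [integrable_indicator_iff measurableSet_Icc]
    exact ContinuousOn.integrableOn_compact isCompact_Icc continuousOn_const
  refine ⟨∏ i : Fin n with i ≠ 0, ∫ y, g y, Finset.prod_nonneg fun i _ => integral_nonneg fun y =>
    Set.indicator_nonneg (fun _ _ => zero_le_one) y, fun m hm => ?_⟩
  set f : Fin n → ℝ → ℝ := fun i => (if i = 0 then
    (Set.Icc (Real.exp (-2 * m)) (Real.exp (2 * m))).indicator (fun y => y⁻¹) else g) with hf
  have hfi : ∀ i, Integrable (f i) := by
    intro i
    by_cases hi : i = 0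
    · simp only [hf, if_pos hi]; exact (int_inv_Icc hm).1
    · simp only [hf, if_neg hi]; exact hg
  have A : Integrable (fun x : Fin n → ℝ => ∏ i, f i (x i)) := Integrable.fintype_prod hfi
  have B : ∫ x : Fin n → ℝ, ∏ i, f i (x i) = ∏ i, ∫ y, f i y :=
    integral_fintype_prod_volume_eq_prod f
  have mp := PiLp.volume_preserving_ofLp (Fin n)
  constructor
  · exact mp.integrable_comp_of_integrable A
  · have e : ∫ x : EuclideanSpace ℝ (Fin n), ∏ i, f i (x i) = ∫ x : Fin n → ℝ, ∏ i, f i (x i) :=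
      mp.integral_comp (MeasurableEquiv.toLp 2 (Fin n → ℝ)).symm.measurableEmbedding
        (fun x => ∏ i, f i (x i))
    refine e.trans ?_
    rw [B, ← Finset.mul_prod_erase Finset.univ _ (Finset.mem_univ 0), ← (int_inv_Icc hm).2]
    refine congrArg₂ (· * ·) ?_ ?_
    · simp [hf]
    · rw [Finset.filter_ne']
      apply Finset.prod_congr rfl
      intro i hi
      simp [hf, (Finset.mem_erase.mp hi).1]

theorem halfspace_hardy_critical {n : ℕ} [NeZero n] (hn : 2 ≤ n) (μ : ℝ) (hμ : μ ≤ 1 / 4)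
    (W : EuclideanSpace ℝ (Fin n) → ℝ≥0∞) (hW : Measurable W)
    (hWpos : 0 < volume {x | x ∈ Hplus n ∧ 0 < W x}) :
    ∃ φ : EuclideanSpace ℝ (Fin n) → ℝ, IsTestFun (Hplus n) φ ∧
      ((∫⁻ x in Hplus n, W x * ENNReal.ofReal ((φ x) ^ 2)) = ⊤ ∨
        (∫ x in Hplus n, ‖gradient φ x‖ ^ 2)
            - μ * ∫ x in Hplus n, (φ x) ^ 2 / (x 0) ^ 2 <
          (((n : ℝ) - 1 + Real.sqrt (1 - 4 * μ)) ^ 2 / 4) *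
              (∫ x in Hplus n, (φ x) ^ 2 / ‖x‖ ^ 2)
            + (∫⁻ x in Hplus n, W x * ENNReal.ofReal ((φ x) ^ 2)).toReal) := by
  set s := Real.sqrt (1 - 4 * μ) with hs
  have hs0 : 0 ≤ s := Real.sqrt_nonneg _
  have hs2 : s ^ 2 = 1 - 4 * μ := Real.sq_sqrt (by linarith)
  obtain ⟨α, hα⟩ : ∃ α : ℝ, α = (1 + s) / 2 := ⟨_, rfl⟩
  obtain ⟨β, hβ⟩ : ∃ β : ℝ, β = (n - 1 + s) / 2 := ⟨_, rfl⟩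
  have h1 : α ^ 2 - α = -μ := by rw [hα]; nlinarith
  have h2 : 2 * β = n - 2 + 2 * α := by rw [hα, hβ]; ring
  have hα2 : 1 / 2 ≤ α := by rw [hα]; linarith
  have hβ2 : ((n : ℝ) - 1 + s) ^ 2 / 4 = β ^ 2 := by rw [hβ]; ring
  rw [hβ2]
  obtain ⟨b, C, hb, hb1, hb2, hbone, hb0, hC, hC0⟩ := exists_bump
  let S : ℕ → Set (EuclideanSpace ℝ (Fin n)) := fun j =>
    {x | (x ∈ Hplus n ∧ |Real.log ‖x‖| ≤ j) ∧ |Real.log (x 0)| ≤ j}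
  have hm0 : Measurable fun x : EuclideanSpace ℝ (Fin n) => x 0 :=
    (coord_contDiff (n := n) 0).continuous.measurable
  have hSm : ∀ j, MeasurableSet (S j) := by
    intro j
    refine ((isOpen_Hplus n).measurableSet.inter ?_).inter ?_
    · exact measurableSet_le (Real.measurable_log.comp measurable_norm).abs measurable_const
    · exact measurableSet_le (Real.measurable_log.comp hm0).abs measurable_const
  let P : Set (EuclideanSpace ℝ (Fin n)) := {x | 0 < W x}
  obtain ⟨j, hj⟩ : ∃ j : ℕ, 0 < volume (P ∩ S j) := by
    by_contra! hne
    have hsub : {x | x ∈ Hplus n ∧ 0 < W x} ⊆ ⋃ j, P ∩ S j := by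
      rintro x ⟨hx, hWx⟩
      obtain ⟨j, hj⟩ := exists_nat_ge (max |Real.log ‖x‖| |Real.log (x 0)|)
      exact Set.mem_iUnion.mpr ⟨j, hWx, ⟨hx, (le_max_left _ _).trans hj⟩, (le_max_right _ _).trans hj⟩
    have := measure_mono_null hsub (measure_iUnion_null fun j => nonpos_iff_eq_zero.mp (hne j))
    exact hWpos.ne' this
  let ψ : EuclideanSpace ℝ (Fin n) → ℝ := fun x =>
    Real.exp (α * Real.log (x 0) - β * Real.log ‖x‖)
  have hψm : Measurable ψ := (((Real.measurable_log.comp hm0).const_mul α).sub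
    ((Real.measurable_log.comp measurable_norm).const_mul β)).exp
  obtain ⟨c, hc⟩ : ∃ c, c = ∫⁻ x in S j, W x * ENNReal.ofReal ((ψ x) ^ 2) := ⟨_, rfl⟩
  have hcpos : 0 < c := by
    have hmeas : Measurable fun x => W x * ENNReal.ofReal ((ψ x) ^ 2) :=
      hW.mul (hψm.pow_const 2).ennreal_ofReal
    rw [hc, setLIntegral_pos_iff hmeas]
    refine lt_of_lt_of_le hj (measure_mono ?_)
    rintro x ⟨hWx, hxS⟩
    refine ⟨?_, hxS⟩
    have hWx' : 0 < W x := hWx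
    have : 0 < ψ x ^ 2 := by have : 0 < ψ x := Real.exp_pos _
                             positivity
    simp only [Function.mem_support]
    exact mul_ne_zero hWx'.ne' (by simpa using this.ne')
  have hlow : ∀ k m : ℝ, 0 < k → 0 < m → j ≤ k → j ≤ m →
      c ≤ ∫⁻ x in Hplus n, W x * ENNReal.ofReal ((tf b α β k m x) ^ 2) := by
    intro k m hk hm hjk hjm
    rw [hc]
    refine le_trans ?_ (lintegral_mono_set (fun x (hx : x ∈ S j) => hx.1.1))
    refine (setLIntegral_congr_fun (hSm j) ?_).le
    intro x hx
    have hx0 : 0 < x 0 := hx.1.1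
    have e1 : b (Real.log ‖x‖ / k) = 1 := hbone _ (by
      rw [abs_div, abs_of_pos hk, div_le_one hk]; exact hx.1.2.trans hjk)
    have e2 : b (Real.log (x 0) / m) = 1 := hbone _ (by
      rw [abs_div, abs_of_pos hm, div_le_one hm]; exact hx.2.trans hjm)
    simp [tf, hx0, e1, e2, ψ]
  by_cases hctop : c = ⊤
  · refine ⟨tf b α β (j + 1) (j + 1), tf_test hb hb0 α β (by positivity) (by positivity), Or.inl ?_⟩
    exact top_le_iff.mp (hctop ▸ hlow (j + 1) (j + 1) (by positivity) (by positivity) (by simp) (by simp))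
  have hcr : 0 < c.toReal := ENNReal.toReal_pos hcpos.ne' hctop
  obtain ⟨V, hV⟩ : ∃ V, V = (n : ℝ) *
    (volume : Measure (EuclideanSpace ℝ (Fin n))).real (Metric.ball 0 1) := ⟨_, rfl⟩
  have hchoose : ∀ T : ℝ, ∃ k : ℝ, 0 < k ∧ (j : ℝ) ≤ k ∧ T / k < c.toReal / 2 := by
    intro T
    have ht : Filter.Tendsto (fun k : ℝ => T / k) Filter.atTop (nhds 0) :=
      Filter.Tendsto.div_atTop tendsto_const_nhds Filter.tendsto_id
    have := ((Filter.eventually_gt_atTop (0 : ℝ)).and ((Filter.eventually_ge_atTop (j : ℝ)).and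
      (ht.eventually_lt_const (half_pos hcr)))).exists
    exact this
  obtain ⟨k, hk, hjk, hkT⟩ := hchoose (8 * C ^ 2 * V)
  obtain ⟨D, hD, hDm⟩ := int_box (n := n) k
  obtain ⟨m, hm, hjm, hmT⟩ := hchoose (8 * C ^ 2 * Real.exp (2 * k * (n - 1)) * D)
  have htest : IsTestFun (Hplus n) (tf b α β k m) := tf_test hb hb0 α β hk hm
  refine ⟨tf b α β k m, htest, ?_⟩
  by_cases htop : (∫⁻ x in Hplus n, W x * ENNReal.ofReal ((tf b α β k m x) ^ 2)) = ⊤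
  · exact Or.inl htop
  right
  have hlow' := ENNReal.toReal_mono htop (hlow k m hk hm hjk hjm)
  have hid := energy_identity α β μ h1 h2 htest
  have hI1 := int_radial (n := n) hk
  have hI2 := hDm m hm
  have hint := (hI1.1.const_mul (2 * C ^ 2 / k ^ 2)).add
    (hI2.1.const_mul (2 * C ^ 2 / m ^ 2 * Real.exp (2 * k * (n - 1))))
  have hup : ∫ x in Hplus n, ‖gradient (tf b α β k m) x - tf b α β k m x • gsA α β x‖ ^ 2 ≤
      8 * C ^ 2 * V / k + 8 * C ^ 2 * Real.exp (2 * k * (n - 1)) * D / m := by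
    refine (integral_mono_of_nonneg (Filter.Eventually.of_forall fun x => sq_nonneg _)
      (hint.integrableOn (s := Hplus n)) ((ae_restrict_iff' (isOpen_Hplus n).measurableSet).mpr
        (Filter.Eventually.of_forall fun x hx =>
          tf_bound hb hb1 hb2 hb0 hC hC0 hα2 h2 hk hm hx))).trans ?_
    refine (setIntegral_le_integral hint (Filter.Eventually.of_forall fun x => ?_)).trans ?_
    · refine add_nonneg (mul_nonneg (by positivity) ?_) (mul_nonneg (by positivity)
        (Finset.prod_nonneg fun i _ => ?_))
      · exact Set.indicator_apply_nonneg fun _ => by positivity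
      · split_ifs
        · exact Set.indicator_apply_nonneg fun h =>
            inv_nonneg.mpr ((Real.exp_pos _).le.trans h.1)
        · exact Set.indicator_apply_nonneg fun _ => zero_le_one
    · rw [integral_add' (hI1.1.const_mul _) (hI2.1.const_mul _), integral_const_mul,
        integral_const_mul, hI1.2, hI2.2, hV]
      apply le_of_eq
      field_simp
      ring
  linarith
end
end

section
/- Null-criticality at 0 and at infinity in the half-space (Theorem 6.1(3) for Ω = ℝⁿ₊): let n ≥ 2, μ ≤ 1/4, η(μ) := n − 1 + √(1 − 4μ), α₊ := (1 + √(1 − 4μ))/2, and define v : ℝⁿ₊ → ℝ by v(x) := x₁^{α₊} |x|^{−η(μ)/2} (the ground state of the critical operator −Δ − μ/x₁² − η(μ)²/(4|x|²) in ℝⁿ₊). Then for every R > 0: ∫_{ℝⁿ₊ ∩ B(0,R)} v(x)²/|x|² dx = ∞ and ∫_{ℝⁿ₊ ∖ B(0,R)} v(x)²/|x|² dx = ∞; i.e., the ground state fails to be square-integrable against the optimal Hardy weight |x|^{−2} both near the origin and near infinity. -/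
open MeasureTheory

noncomputable section

lemma hs_scale {n : ℕ} [NeZero n] (g : EuclideanSpace ℝ (Fin n) → ℝ) (hg : Measurable g)
    (hh : ∀ x, 0 < x 0 → ∀ c : ℝ, 0 < c → g (c • x) = (c ^ n)⁻¹ * g x)
    (R : ℝ) (c : ℝ) (hc : 0 < c) :
    (∫⁻ x in Hplus n ∩ {x | c * R ≤ ‖x‖ ∧ ‖x‖ < c * (2 * R)}, ENNReal.ofReal (g x)) =
    (∫⁻ x in Hplus n ∩ {x | R ≤ ‖x‖ ∧ ‖x‖ < 2 * R}, ENNReal.ofReal (g x)) := by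
  have hH : ∀ a b : ℝ, MeasurableSet (Hplus n ∩ {x | a ≤ ‖x‖ ∧ ‖x‖ < b}) := by
    intro a b
    unfold Hplus
    apply MeasurableSet.inter
    · exact measurableSet_lt measurable_const (by fun_prop)
    · exact (measurableSet_le measurable_const measurable_norm).inter
        (measurableSet_lt measurable_norm measurable_const)
  have hmap := Measure.map_addHaar_smul (volume : Measure (EuclideanSpace ℝ (Fin n))) hc.ne'
  rw [finrank_euclideanSpace_fin] at hmap
  have hpos : 0 < (c ^ n)⁻¹ := by positivity
  rw [abs_of_pos hpos] at hmap
  rw [← lintegral_indicator (hH _ _), ← lintegral_indicator (hH _ _)]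
  set F := (Hplus n ∩ {x | c * R ≤ ‖x‖ ∧ ‖x‖ < c * (2 * R)}).indicator
    (fun x => ENNReal.ofReal (g x)) with hF
  set G := (Hplus n ∩ {x | R ≤ ‖x‖ ∧ ‖x‖ < 2 * R}).indicator
    (fun x => ENNReal.ofReal (g x)) with hG
  have hFm : Measurable F := hg.ennreal_ofReal.indicator (hH _ _)
  have hGm : Measurable G := hg.ennreal_ofReal.indicator (hH _ _)
  have h1 : ∫⁻ x, F (c • x) = ENNReal.ofReal (c ^ n)⁻¹ * ∫⁻ x, F x := by
    rw [← lintegral_map hFm (measurable_const_smul c), hmap, lintegral_smul_measure, smul_eq_mul]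
  have h2 : ∀ x, F (c • x) = ENNReal.ofReal (c ^ n)⁻¹ * G x := by
    intro x
    have hmem : (c • x ∈ Hplus n ∩ {x | c * R ≤ ‖x‖ ∧ ‖x‖ < c * (2 * R)}) ↔
        x ∈ Hplus n ∩ {x | R ≤ ‖x‖ ∧ ‖x‖ < 2 * R} := by
      simp only [Hplus, Set.mem_inter_iff, Set.mem_ofPred_eq, norm_smul, Real.norm_eq_abs,
        abs_of_pos hc, PiLp.smul_apply, smul_eq_mul, mul_pos_iff_of_pos_left hc,
        mul_le_mul_iff_right₀ hc, mul_lt_mul_iff_right₀ hc]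
    by_cases hx : x ∈ Hplus n ∩ {x | R ≤ ‖x‖ ∧ ‖x‖ < 2 * R}
    · rw [hF, hG, Set.indicator_of_mem hx, Set.indicator_of_mem (hmem.2 hx),
        hh x hx.1 c hc, ENNReal.ofReal_mul hpos.le]
    · rw [hF, hG, Set.indicator_of_notMem hx, Set.indicator_of_notMem (fun h => hx (hmem.1 h)),
        mul_zero]
  simp_rw [h2] at h1
  rw [lintegral_const_mul _ hGm] at h1
  exact ((ENNReal.mul_right_inj (ENNReal.ofReal_pos.2 hpos).ne' ENNReal.ofReal_ne_top).1 h1).symm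

lemma hs_pos {n : ℕ} [NeZero n] (g : EuclideanSpace ℝ (Fin n) → ℝ) (hg : Measurable g)
    (hp : ∀ x, 0 < x 0 → 0 < g x) (R : ℝ) (hR : 0 < R) :
    (∫⁻ x in Hplus n ∩ {x | R ≤ ‖x‖ ∧ ‖x‖ < 2 * R}, ENNReal.ofReal (g x)) ≠ 0 := by
  have hsub : Hplus n ∩ {x | R < ‖x‖ ∧ ‖x‖ < 2 * R} ⊆
      Hplus n ∩ {x | R ≤ ‖x‖ ∧ ‖x‖ < 2 * R} := fun x hx => ⟨hx.1, hx.2.1.le, hx.2.2⟩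
  have hopen : IsOpen (Hplus n ∩ {x | R < ‖x‖ ∧ ‖x‖ < 2 * R}) := by
    unfold Hplus
    apply IsOpen.inter
    · exact isOpen_lt continuous_const (by fun_prop)
    · exact (isOpen_lt continuous_const continuous_norm).inter
        (isOpen_lt continuous_norm continuous_const)
  have hne : (Hplus n ∩ {x | R < ‖x‖ ∧ ‖x‖ < 2 * R}).Nonempty := by
    refine ⟨EuclideanSpace.single 0 (3 / 2 * R), ?_, ?_, ?_⟩
    · simp [Hplus, hR]
    · simp [abs_of_pos hR]; linarith
    · simp [abs_of_pos hR]; linarith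
  have hvol := hopen.measure_pos volume hne
  refine ne_of_gt (lt_of_lt_of_le ?_ (lintegral_mono_set hsub))
  rw [setLIntegral_pos_iff hg.ennreal_ofReal]
  refine lt_of_lt_of_le hvol (measure_mono fun x hx => ⟨?_, hx⟩)
  exact (ENNReal.ofReal_pos.2 (hp x hx.1)).ne'

lemma hs_top {n : ℕ} [NeZero n] (g : EuclideanSpace ℝ (Fin n) → ℝ) (hg : Measurable g)
    (hp : ∀ x, 0 < x 0 → 0 < g x)
    (hh : ∀ x, 0 < x 0 → ∀ c : ℝ, 0 < c → g (c • x) = (c ^ n)⁻¹ * g x)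
    (R : ℝ) (hR : 0 < R) (k : ℕ → ℤ) (hk : Function.Injective k)
    (S : Set (EuclideanSpace ℝ (Fin n)))
    (hS : ∀ j, Hplus n ∩ {x | (2 : ℝ) ^ k j * R ≤ ‖x‖ ∧ ‖x‖ < (2 : ℝ) ^ k j * (2 * R)} ⊆ S) :
    (∫⁻ x in S, ENNReal.ofReal (g x)) = ⊤ := by
  have hH : ∀ a b : ℝ, MeasurableSet (Hplus n ∩ {x | a ≤ ‖x‖ ∧ ‖x‖ < b}) := by
    intro a b
    unfold Hplus
    apply MeasurableSet.inter
    · exact measurableSet_lt measurable_const (by fun_prop)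
    · exact (measurableSet_le measurable_const measurable_norm).inter
        (measurableSet_lt measurable_norm measurable_const)
  refine top_unique (le_trans ?_ (lintegral_mono_set (Set.iUnion_subset hS)))
  rw [lintegral_iUnion (fun j => hH _ _)]
  · simp_rw [fun j => hs_scale g hg hh R ((2 : ℝ) ^ k j) (by positivity)]
    rw [ENNReal.tsum_const_eq_top_of_ne_zero (hs_pos g hg hp R hR)]
  · have key : ∀ a b : ℤ, a < b → (2 : ℝ) ^ a * (2 * R) ≤ (2 : ℝ) ^ b * R := by
      intro a b hab
      have h : (2 : ℝ) ^ (a + 1) ≤ (2 : ℝ) ^ b := zpow_le_zpow_right₀ (by norm_num) hab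
      rw [zpow_add_one₀ (by norm_num)] at h
      nlinarith
    intro i j hij
    refine Set.disjoint_left.2 fun x hx hy => ?_
    have h1 := hx.2.1
    have h2 := hx.2.2
    have h3 := hy.2.1
    have h4 := hy.2.2
    rcases lt_or_gt_of_ne (hk.ne hij) with h | h
    · linarith [key _ _ h]
    · linarith [key _ _ h]

/-- Null-criticality at `0` and at infinity in the half-space: the ground state
`v(x) = x₁^{α₊} |x|^{-η(μ)/2}` fails to be square-integrable against the optimal Hardy
weight `|x|⁻²` both near the origin and near infinity. -/
theorem halfspace_null_critical {n : ℕ} [NeZero n] (hn : 2 ≤ n) (μ : ℝ) (hμ : μ ≤ 1 / 4)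
    (v : EuclideanSpace ℝ (Fin n) → ℝ)
    (hv : ∀ x, v x = (x 0) ^ ((1 + Real.sqrt (1 - 4 * μ)) / 2) *
      ‖x‖ ^ (-(((n : ℝ) - 1 + Real.sqrt (1 - 4 * μ)) / 2)))
    (R : ℝ) (hR : 0 < R) :
    (∫⁻ x in Hplus n ∩ Metric.ball 0 R, ENNReal.ofReal ((v x) ^ 2 / ‖x‖ ^ 2)) = ⊤ ∧
    (∫⁻ x in Hplus n \ Metric.ball 0 R, ENNReal.ofReal ((v x) ^ 2 / ‖x‖ ^ 2)) = ⊤ := by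
  have hvm : Measurable v := by
    rw [funext hv]
    fun_prop
  have hg : Measurable fun x => (v x) ^ 2 / ‖x‖ ^ 2 := by fun_prop
  have hnorm : ∀ x : EuclideanSpace ℝ (Fin n), 0 < x 0 → 0 < ‖x‖ := by
    intro x hx
    rw [norm_pos_iff]
    rintro rfl
    simp at hx
  have hp : ∀ x, 0 < x 0 → 0 < (v x) ^ 2 / ‖x‖ ^ 2 := by
    intro x hx
    have h1 := hnorm x hx
    rw [hv]
    have := Real.rpow_pos_of_pos hx ((1 + Real.sqrt (1 - 4 * μ)) / 2)
    positivity
  have hh : ∀ x, 0 < x 0 → ∀ c : ℝ, 0 < c →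
      (v (c • x)) ^ 2 / ‖c • x‖ ^ 2 = (c ^ n)⁻¹ * ((v x) ^ 2 / ‖x‖ ^ 2) := by
    intro x hx c hc
    have h1 := hnorm x hx
    rw [hv, hv, norm_smul, Real.norm_eq_abs, abs_of_pos hc, PiLp.smul_apply, smul_eq_mul,
      Real.mul_rpow hc.le hx.le, Real.mul_rpow hc.le h1.le]
    set s := Real.sqrt (1 - 4 * μ)
    have e : (c ^ ((1 + s) / 2) * c ^ (-(((n : ℝ) - 1 + s) / 2))) ^ 2 / c ^ 2 = (c ^ n)⁻¹ := by
      rw [← Real.rpow_add hc, ← Real.rpow_natCast, ← Real.rpow_natCast, ← Real.rpow_natCast,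
        ← Real.rpow_mul hc.le, ← Real.rpow_sub hc, ← Real.rpow_neg hc.le]
      congr 1
      push_cast
      ring
    rw [← e]
    field_simp
  constructor
  · refine hs_top _ hg hp hh R hR (fun j => -((j : ℤ) + 1)) (fun i j h => by simpa using h) _ ?_
    rintro j x ⟨hx, h1, h2⟩
    refine ⟨hx, ?_⟩
    rw [mem_ball_zero_iff]
    have h : (2 : ℝ) ^ (-((j : ℤ) + 1)) ≤ (2 : ℝ) ^ (-1 : ℤ) :=
      zpow_le_zpow_right₀ (by norm_num) (by omega)
    have h' : (2 : ℝ) ^ (-1 : ℤ) = 1 / 2 := by norm_num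
    rw [h'] at h
    nlinarith
  · refine hs_top _ hg hp hh R hR (fun j => (j : ℤ)) (fun i j h => by simpa using h) _ ?_
    rintro j x ⟨hx, h1, h2⟩
    refine ⟨hx, ?_⟩
    rw [mem_ball_zero_iff, not_lt]
    have h : (1 : ℝ) ≤ (2 : ℝ) ^ (j : ℤ) := one_le_zpow₀ (by norm_num) (by omega)
    nlinarith
end
end

section
/- Validity of the Filippas–Tertikas–Tidblom family of Hardy inequalities in the half-space (inequality (7.1), sufficiency): let n ≥ 2, let α₁, …, α_n ∈ ℝ, and define β₁ := 1/4 − α₁² and β_i := (α_{i−1} − 1/2)² − α_i² for 2 ≤ i ≤ n. Then for every φ ∈ C_c^∞(ℝⁿ₊): ∫_{ℝⁿ₊} |∇φ(x)|² dx ≥ ∫_{ℝⁿ₊} ( β₁/x₁² + β₂/(x₁² + x₂²) + ⋯ + β_n/(x₁² + ⋯ + x_n²) ) φ(x)² dx. -/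
open MeasureTheory

noncomputable section

lemma ftt_dsum {n : ℕ} (c a : Fin n → ℝ) :
    ∑ i, ∑ j, c i * c j * a (max i j) =
      ∑ j, (c j ^ 2 + 2 * c j * ∑ i, if i < j then c i else 0) * a j := by
  have h : ∀ i j, c i * c j * a (max i j) =
      (if i < j then c i * c j * a j else 0) + (if j < i then c i * c j * a i else 0)
        + (if i = j then c j ^ 2 * a j else 0) := by
    intro i j
    rcases lt_trichotomy i j with h | h | h
    · simp [h, h.le, h.not_gt, h.ne]
    · subst h; simp only [lt_irrefl, if_false, if_true, max_self]; ring
    · simp [h, h.le, h.not_gt, h.ne']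
  simp_rw [h, Finset.sum_add_distrib]
  rw [Finset.sum_comm]
  simp only [Finset.sum_ite_eq, Finset.mem_univ, if_true]
  rw [← Finset.sum_add_distrib, ← Finset.sum_add_distrib]
  apply Finset.sum_congr rfl
  intro j _
  have h1 : (∑ i, if i < j then c i * c j * a j else 0) =
      (∑ i, if i < j then c i else 0) * (c j * a j) := by
    rw [Finset.sum_mul]; apply Finset.sum_congr rfl; intro i _; split_ifs <;> ring
  have h2 : (∑ i, if i < j then c j * c i * a j else 0) =
      (∑ i, if i < j then c i else 0) * (c j * a j) := by
    rw [Finset.sum_mul]; apply Finset.sum_congr rfl; intro i _; split_ifs <;> ring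
  rw [h1, h2]; ring

lemma ftt_tele {n : ℕ} (T : ℕ → ℝ) (j : Fin n) :
    (∑ i : Fin n, if i < j then T (i + 1) - T i else 0) = T j - T 0 := by
  have h := Fin.sum_univ_eq_sum_range (fun m : ℕ => if m < (j : ℕ) then T (m + 1) - T m else 0) n
  rw [← Finset.sum_range_sub, ← Finset.sum_filter_add_sum_filter_not (Finset.univ : Finset (Fin n)) (fun i => i < j)]
  rw [Finset.sum_filter_add_sum_filter_not]
  simp only [Fin.lt_def]
  rw [h, ← Finset.sum_filter]
  congr 1
  ext m
  simp only [Finset.mem_filter, Finset.mem_range]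
  have := j.2
  omega

/-- choice of coefficients -/
lemma ftt_coef {n : ℕ} [NeZero n] (α β : Fin n → ℝ)
    (hβ0 : β 0 = 1 / 4 - (α 0) ^ 2)
    (hβ : ∀ i : Fin n, 0 < (i : ℕ) → β i = (α (i - 1) - 1 / 2) ^ 2 - (α i) ^ 2) :
    ∃ c : Fin n → ℝ, ∀ j, β j = c j * ((j : ℝ) - 1) -
      (c j ^ 2 + 2 * c j * ∑ i, if i < j then c i else 0) := by
  let T : ℕ → ℝ := fun m => if m = 0 then 0 else
    (if h : m - 1 < n then α ⟨m - 1, h⟩ else 0) + ((m : ℝ) - 2) / 2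
  refine ⟨fun i => T (i + 1) - T i, fun j => ?_⟩
  rw [ftt_tele]
  have hT0 : T 0 = 0 := by simp [T]
  have hT1 : T (j + 1) = α j + ((j : ℝ) - 1) / 2 := by
    simp [T]; ring
  beta_reduce
  rw [hT0, hT1]
  by_cases hj : (j : ℕ) = 0
  · have : j = 0 := Fin.ext (by simpa using hj)
    subst this
    rw [hβ0, hj, hT0]; push_cast; ring
  · have hj1 : ((j - 1 : Fin n) : ℕ) = j - 1 := by
      have := j.2
      have h1 : (1 : Fin n).val = 1 := by
        rw [Fin.val_one']; exact Nat.mod_eq_of_lt (by omega)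
      rw [Fin.sub_val_of_le, h1]
      rw [Fin.le_def, h1]; omega
    have hT : T j = α (j - 1) + ((j : ℝ) - 2) / 2 := by
      have h3 : (j : ℕ) - 1 < n := by have := j.2; omega
      have h4 : (⟨(j : ℕ) - 1, h3⟩ : Fin n) = j - 1 := Fin.ext hj1.symm
      simp only [T, if_neg hj, dif_pos h3, h4]
    rw [hT, hβ j (by omega)]; ring

section
variable {n : ℕ}

/-- partial square sums -/
def fttR (i : Fin n) (x : EuclideanSpace ℝ (Fin n)) : ℝ := ∑ j ∈ Finset.Iic i, (x j) ^ 2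

/-- vector field -/
def fttG (c : Fin n → ℝ) (k : Fin n) (x : EuclideanSpace ℝ (Fin n)) : ℝ :=
  ∑ i, if k ≤ i then c i * (x k * (fttR i x)⁻¹) else 0

lemma fttR_pos [NeZero n] (i : Fin n) {x : EuclideanSpace ℝ (Fin n)} (hx : x ∈ Hplus n) :
    0 < fttR i x := by
  have hx' : 0 < x 0 := hx
  have : (x 0) ^ 2 ≤ fttR i x := by
    unfold fttR
    exact Finset.single_le_sum (f := fun j => (x j) ^ 2) (fun j _ => sq_nonneg _) (by simp)
  exact lt_of_lt_of_le (by positivity) this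

lemma fttR_contDiff (i : Fin n) : ContDiff ℝ 1 (fttR i) := by
  unfold fttR; fun_prop

lemma fttG_contDiffAt [NeZero n] (c : Fin n → ℝ) (k : Fin n) {x : EuclideanSpace ℝ (Fin n)}
    (hx : x ∈ Hplus n) : ContDiffAt ℝ 1 (fttG c k) x := by
  unfold fttG
  apply ContDiffAt.sum
  intro i _
  split_ifs
  · have h1 := (fttR_contDiff i).contDiffAt.inv (x := x) (fttR_pos i hx).ne'
    have h2 : ContDiffAt ℝ 1 (fun x : EuclideanSpace ℝ (Fin n) => x k) x := by fun_prop
    exact contDiffAt_const.mul (h2.mul h1)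
  · exact contDiffAt_const

lemma ftt_contDiff [NeZero n] {φ g : EuclideanSpace ℝ (Fin n) → ℝ} (hφ : IsTestFun (Hplus n) φ)
    (hg : ∀ x ∈ Hplus n, ContDiffAt ℝ 1 g x) : ContDiff ℝ 1 (fun x => φ x ^ 2 * g x) := by
  rw [contDiff_iff_contDiffAt]
  intro x
  by_cases hx : x ∈ tsupport φ
  · have h1 : ContDiffAt ℝ 1 φ x := (hφ.1.of_le (by exact_mod_cast le_top)).contDiffAt
    exact (h1.pow 2).mul (hg x (hφ.2.2 hx))
  · have h := notMem_tsupport_iff_eventuallyEq.mp hx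
    apply (contDiffAt_const (c := (0 : ℝ))).congr_of_eventuallyEq
    filter_upwards [h] with y hy
    simp [hy]

lemma ftt_compact [NeZero n] {φ g : EuclideanSpace ℝ (Fin n) → ℝ} (hφ : IsTestFun (Hplus n) φ) :
    HasCompactSupport (fun x => φ x ^ 2 * g x) := by
  apply HasCompactSupport.mono hφ.2.1
  intro x hx
  simp only [Function.mem_support] at hx ⊢
  intro h; simp [h] at hx

lemma ftt_int_zero {f : EuclideanSpace ℝ (Fin n) → ℝ} (hf : ContDiff ℝ 1 f)
    (hc : HasCompactSupport f) (v : EuclideanSpace ℝ (Fin n)) :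
    Integrable (fun x => fderiv ℝ f x v) ∧ ∫ x, fderiv ℝ f x v = 0 := by
  have hi : Integrable (fun x => fderiv ℝ f x v) := by
    apply Continuous.integrable_of_hasCompactSupport
    · exact (hf.continuous_fderiv one_ne_zero).clm_apply continuous_const
    · exact hc.fderiv_apply ℝ v
  refine ⟨hi, ?_⟩
  have := integral_mul_fderiv_eq_neg_fderiv_mul_of_integrable (𝕜 := ℝ) (μ := volume)
    (f := fun _ : EuclideanSpace ℝ (Fin n) => (1 : ℝ)) (g := f) (v := v)
    (by simp) (by simpa using hi)
    (by simpa using hf.continuous.integrable_of_hasCompactSupport hc) (by fun_prop)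
    (fun x _ => hf.differentiable one_ne_zero x)
  simpa using this

lemma fttR_deriv (i k : Fin n) (hk : k ≤ i) (x : EuclideanSpace ℝ (Fin n)) :
    fderiv ℝ (fttR i) x (EuclideanSpace.single k 1) = 2 * x k := by
  have h : HasFDerivAt (fttR i) (∑ j ∈ Finset.Iic i,
      (2 * x j) • (EuclideanSpace.proj j : EuclideanSpace ℝ (Fin n) →L[ℝ] ℝ)) x := by
    unfold fttR
    apply HasFDerivAt.fun_sum
    intro j _
    have := ((EuclideanSpace.proj j : EuclideanSpace ℝ (Fin n) →L[ℝ] ℝ).hasFDerivAt (x := x)).pow 2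
    simpa using this
  rw [h.fderiv]
  simp [ContinuousLinearMap.sum_apply, Pi.single_apply, hk]

lemma fttG_deriv [NeZero n] (c : Fin n → ℝ) (k : Fin n) {x : EuclideanSpace ℝ (Fin n)}
    (hx : x ∈ Hplus n) : fderiv ℝ (fttG c k) x (EuclideanSpace.single k 1) =
      ∑ i, if k ≤ i then c i * ((fttR i x)⁻¹ - 2 * (x k) ^ 2 * ((fttR i x)⁻¹) ^ 2) else 0 := by
  have h : HasFDerivAt (fttG c k) (∑ i, if k ≤ i then
      c i • (x k • (-((fttR i x) ^ 2)⁻¹ • fderiv ℝ (fttR i) x) +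
       (fttR i x)⁻¹ • (EuclideanSpace.proj k : EuclideanSpace ℝ (Fin n) →L[ℝ] ℝ)) else 0) x := by
    unfold fttG
    apply HasFDerivAt.fun_sum
    intro i _
    split_ifs
    · apply HasFDerivAt.const_mul
      apply HasFDerivAt.mul
      · exact (EuclideanSpace.proj k : EuclideanSpace ℝ (Fin n) →L[ℝ] ℝ).hasFDerivAt
      · exact (hasDerivAt_inv (fttR_pos i hx).ne').comp_hasFDerivAt x
          ((fttR_contDiff i).differentiable one_ne_zero x).hasFDerivAt
    · exact hasFDerivAt_const _ _
  rw [h.fderiv, ContinuousLinearMap.sum_apply]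
  apply Finset.sum_congr rfl
  intro i _
  split_ifs with hk
  · simp [fttR_deriv i k hk]
    ring
  · simp

lemma ftt_swap (c : Fin n → Fin n → ℝ) :
    (∑ k, ∑ i, if k ≤ i then c k i else 0) = ∑ i, ∑ k ∈ Finset.Iic i, c k i := by
  rw [Finset.sum_comm]
  apply Finset.sum_congr rfl
  intro i _
  rw [← Finset.sum_filter]
  congr 1
  ext; simp

lemma fttG_div [NeZero n] (c : Fin n → ℝ) {x : EuclideanSpace ℝ (Fin n)}
    (hx : x ∈ Hplus n) : ∑ k, fderiv ℝ (fttG c k) x (EuclideanSpace.single k 1) =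
      ∑ i, c i * ((i : ℝ) - 1) * (fttR i x)⁻¹ := by
  simp_rw [fttG_deriv c _ hx]
  rw [ftt_swap]
  apply Finset.sum_congr rfl
  intro i _
  have h := (fttR_pos i hx).ne'
  rw [← Finset.mul_sum, Finset.sum_sub_distrib, ← Finset.sum_mul, ← Finset.mul_sum]
  change c i * (_ - 2 * fttR i x * _) = _
  simp only [Finset.sum_const, Fin.card_Iic, nsmul_eq_mul]
  push_cast
  field_simp
  ring

lemma fttG_sq [NeZero n] (c : Fin n → ℝ) {x : EuclideanSpace ℝ (Fin n)}
    (hx : x ∈ Hplus n) : ∑ k, (fttG c k x) ^ 2 =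
      ∑ j, (c j ^ 2 + 2 * c j * ∑ i, if i < j then c i else 0) * (fttR j x)⁻¹ := by
  rw [← ftt_dsum c (fun j => (fttR j x)⁻¹)]
  unfold fttG
  simp_rw [sq, Finset.sum_mul_sum]
  rw [Finset.sum_comm]
  apply Finset.sum_congr rfl
  intro i _
  rw [Finset.sum_comm]
  apply Finset.sum_congr rfl
  intro j _
  have h : ∀ k, (if k ≤ i then c i * (x k * (fttR i x)⁻¹) else 0) *
      (if k ≤ j then c j * (x k * (fttR j x)⁻¹) else 0) =
      if k ≤ min i j then (x k) ^ 2 * (c i * c j * (fttR i x)⁻¹ * (fttR j x)⁻¹) else 0 := by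
    intro k
    by_cases h1 : k ≤ i <;> by_cases h2 : k ≤ j <;> simp [h1, h2]
    ring
  simp_rw [h]
  rw [← Finset.sum_filter, ← Finset.sum_mul]
  have h2 : (∑ k with k ≤ min i j, (x k) ^ 2) = fttR (min i j) x := by
    unfold fttR; congr 1; ext; simp
  rw [h2]
  have hi := (fttR_pos i hx).ne'
  have hj := (fttR_pos j hx).ne'
  rcases le_total i j with h | h
  · rw [min_eq_left h, max_eq_right h]; field_simp
  · rw [min_eq_right h, max_eq_left h]; field_simp

lemma ftt_grad {φ : EuclideanSpace ℝ (Fin n) → ℝ} (x : EuclideanSpace ℝ (Fin n))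
    (hφ : DifferentiableAt ℝ φ x) :
    ‖gradient φ x‖ ^ 2 = ∑ k, (fderiv ℝ φ x (EuclideanSpace.single k 1)) ^ 2 := by
  rw [EuclideanSpace.norm_sq_eq]
  apply Finset.sum_congr rfl
  intro k _
  have : fderiv ℝ φ x (EuclideanSpace.single k 1) = gradient φ x k := by
    have h := hφ.hasGradientAt.hasFDerivAt.fderiv
    have h2 := congrArg (fun L => L (EuclideanSpace.single k 1)) h
    refine h2.trans ?_
    rw [InnerProductSpace.toDual_apply_apply, EuclideanSpace.inner_single_right]
    simp
  rw [this, Real.norm_eq_abs, sq_abs]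

lemma ftt_pointwise [NeZero n] (α β c : Fin n → ℝ)
    (hc : ∀ j, β j = c j * ((j : ℝ) - 1) -
      (c j ^ 2 + 2 * c j * ∑ i, if i < j then c i else 0))
    {φ : EuclideanSpace ℝ (Fin n) → ℝ} {x : EuclideanSpace ℝ (Fin n)}
    (hφ : DifferentiableAt ℝ φ x) (hx : x ∈ Hplus n) :
    φ x ^ 2 * (∑ i : Fin n, β i * (fttR i x)⁻¹) ≤
     ‖gradient φ x‖ ^ 2 +
      ∑ k, fderiv ℝ (fun y => φ y ^ 2 * fttG c k y) x (EuclideanSpace.single k 1) := by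
  have h1 : (∑ i : Fin n, β i * (fttR i x)⁻¹) =
      ∑ k, fderiv ℝ (fttG c k) x (EuclideanSpace.single k 1) - ∑ k, (fttG c k x) ^ 2 := by
    rw [fttG_div c hx, fttG_sq c hx, ← Finset.sum_sub_distrib]
    apply Finset.sum_congr rfl
    intro i _
    rw [hc]; ring
  rw [h1, ftt_grad x hφ, ← Finset.sum_sub_distrib, Finset.mul_sum, ← Finset.sum_add_distrib]
  apply Finset.sum_le_sum
  intro k _
  have h2 := (hφ.hasFDerivAt.pow 2).mul
    ((fttG_contDiffAt c k hx).differentiableAt one_ne_zero).hasFDerivAt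
  have h3 : fderiv ℝ (fun y => φ y ^ 2 * fttG c k y) x = _ := h2.fderiv
  rw [h3]
  simp
  nlinarith [sq_nonneg (fderiv ℝ φ x (EuclideanSpace.single k 1) + φ x * fttG c k x)]

end

/-- Validity of the Filippas–Tertikas–Tidblom family of Hardy inequalities in the
half-space: with `β₁ = 1/4 - α₁²` and `βᵢ = (α_{i-1} - 1/2)² - αᵢ²`, the inequality
`∫ |∇φ|² ≥ ∫ (∑ᵢ βᵢ/(x₁² + ⋯ + xᵢ²)) φ²` holds for all test functions. -/
theorem ftt_hardy {n : ℕ} [NeZero n] (hn : 2 ≤ n) (α β : Fin n → ℝ)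
    (hβ0 : β 0 = 1 / 4 - (α 0) ^ 2)
    (hβ : ∀ i : Fin n, 0 < (i : ℕ) → β i = (α (i - 1) - 1 / 2) ^ 2 - (α i) ^ 2) :
    ∀ φ : EuclideanSpace ℝ (Fin n) → ℝ, IsTestFun (Hplus n) φ →
      (∫ x in Hplus n,
          (∑ i : Fin n, β i / (∑ j ∈ Finset.Iic i, (x j) ^ 2)) * (φ x) ^ 2) ≤
        ∫ x in Hplus n, ‖gradient φ x‖ ^ 2 := by
  intro φ hφ
  obtain ⟨c, hc⟩ := ftt_coef α β hβ0 hβ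
  have hd : Differentiable ℝ φ := hφ.1.differentiable (by simp)
  have hW : ∀ x, (∑ i : Fin n, β i / (∑ j ∈ Finset.Iic i, (x j) ^ 2)) * (φ x) ^ 2 =
      φ x ^ 2 * (∑ i : Fin n, β i * (fttR i x)⁻¹) := by
    intro x; rw [mul_comm]; rfl
  simp_rw [hW]
  have hWi : Integrable (fun x => φ x ^ 2 * (∑ i : Fin n, β i * (fttR i x)⁻¹)) := by
    apply Continuous.integrable_of_hasCompactSupport _ (ftt_compact hφ)
    apply (ftt_contDiff hφ _).continuous
    intro x hx
    apply ContDiffAt.sum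
    intro i _
    exact contDiffAt_const.mul ((fttR_contDiff i).contDiffAt.inv (fttR_pos i hx).ne')
  have hgi : Integrable (fun x => ‖gradient φ x‖ ^ 2) := by
    have h1 : ContDiff ℝ 1 φ := hφ.1.of_le (by exact_mod_cast le_top)
    simp_rw [fun x => ftt_grad x (hd x)]
    apply integrable_finsetSum
    intro k _
    apply Continuous.integrable_of_hasCompactSupport
    · exact ((h1.continuous_fderiv one_ne_zero).clm_apply continuous_const).pow 2
    · exact (hφ.2.1.fderiv_apply ℝ _).comp_left (g := fun t : ℝ => t ^ 2) (by simp)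
  have hk := fun k => ftt_int_zero (ftt_contDiff hφ (fun x hx => fttG_contDiffAt c k hx))
    (ftt_compact hφ) (EuclideanSpace.single k 1)
  have hsi := integrable_finsetSum Finset.univ (fun k _ => (hk k).1)
  have hs0 : ∫ x in Hplus n, ∑ k, fderiv ℝ (fun y => φ y ^ 2 * fttG c k y) x
      (EuclideanSpace.single k 1) = 0 := by
    rw [setIntegral_eq_integral_of_forall_compl_eq_zero]
    · rw [integral_finsetSum _ (fun k _ => (hk k).1)]
      exact Finset.sum_eq_zero (fun k _ => (hk k).2)
    · intro x hx
      apply Finset.sum_eq_zero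
      intro k _
      have h0 : (fun y => φ y ^ 2 * fttG c k y) =ᶠ[nhds x] fun _ => 0 := by
        filter_upwards [notMem_tsupport_iff_eventuallyEq.mp (fun h => hx (hφ.2.2 h))] with y hy
        simp [hy]
      rw [h0.fderiv_eq]; simp
  have hm : MeasurableSet (Hplus n) :=
    (isOpen_lt continuous_const (by fun_prop : Continuous
      (fun x : EuclideanSpace ℝ (Fin n) => x 0))).measurableSet
  calc _ ≤ ∫ x in Hplus n, (‖gradient φ x‖ ^ 2 +
        ∑ k, fderiv ℝ (fun y => φ y ^ 2 * fttG c k y) x (EuclideanSpace.single k 1)) :=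
        setIntegral_mono_on hWi.integrableOn (hgi.add hsi).integrableOn hm
          (fun x hx => ftt_pointwise α β c hc (hd x) hx)
    _ = _ := by
      rw [integral_add hgi.integrableOn hsi.integrableOn, hs0, add_zero]
end
end
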